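/- In the market model with convex cost functions and portfolio constraints, if the set {z ∈ N_{D^∞} : S^∞(Δz) ≤ 0} := {z adapted : z_t(ω) ∈ D_t^∞(ω) and S_t^∞(Δz_t(ω),ω) ≤ 0 for all t, P-a.s.} is a linear subspace of the space of adapted processes, then the infimum of E V(S(Δz) + c) over z ∈ N_D is attained. -/

import Mathlib

open Filter MeasureTheory Metric Set
open scoped Topology ENNReal Pointwise

attribute [local instance] Classical.propDecidable

noncomputable section

/-- Horizon function: g^∞(w) = lim_{δ↓0} inf{ λ g(w'/λ) : 0<λ<δ, |w'-w| ≤ δ }. -/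
def hor {E : Type*} [SeminormedAddCommGroup E] [NormedSpace ℝ E] (g : E → EReal) (w : E) : EReal :=
  ⨆ (δ : ℝ) (_ : 0 < δ), ⨅ (l : ℝ) (_ : l ∈ Set.Ioo (0:ℝ) δ) (w' : E)
      (_ : w' ∈ Metric.closedBall w δ), (l : EReal) * g (l⁻¹ • w')

/-- Positive part of an extended real, as an extended nonnegative real. -/
def ePos (x : EReal) : ℝ≥0∞ := if x = ⊤ then ⊤ else ENNReal.ofReal x.toReal

/-- The extended integral of an EReal-valued function. -/
def eInt {Ω : Type*} [MeasurableSpace Ω] (μ : Measure Ω) (f : Ω → EReal) : EReal :=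
  ((∫⁻ ω, ePos (f ω) ∂μ : ℝ≥0∞) : EReal) + (-((∫⁻ ω, ePos (-(f ω)) ∂μ : ℝ≥0∞) : EReal))

/-- Convexity for (−∞,+∞]-valued functions. -/
def EConvexOn {E : Type*} [AddCommGroup E] [Module ℝ E] (g : E → EReal) : Prop :=
  ∀ x y : E, ∀ a b : ℝ, 0 ≤ a → 0 ≤ b → a + b = 1 →
    g (a • x + b • y) ≤ (a : EReal) * g x + (b : EReal) * g y

/-- The increment Δz_t = z_t − z_{t−1} of a trading strategy, with z_{−1} := 0. -/
def dz {Ω : Type*} {J : ℕ} (z : ℕ → Ω → Fin J → ℝ) (t : ℕ) (ω : Ω) : Fin J → ℝ :=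
  if t = 0 then z 0 ω else z t ω - z (t-1) ω

/-- The horizon cost functions S_t^∞(x,ω) = sup_{α>0} S_t(αx,ω)/α. -/
def Sinf {Ω : Type*} {J : ℕ} (S : ℕ → (Fin J → ℝ) → Ω → EReal) (t : ℕ)
    (x : Fin J → ℝ) (ω : Ω) : EReal :=
  ⨆ (α : ℝ) (_ : 0 < α), ((α⁻¹ : ℝ) : EReal) * S t (α • x) ω

/-- The horizon constraint sets D_t^∞(ω) = ∩_{α>0} α D_t(ω). -/
def Dinf {Ω : Type*} {J : ℕ} (D : ℕ → Ω → Set (Fin J → ℝ)) (t : ℕ) (ω : Ω) :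
    Set (Fin J → ℝ) :=
  ⋂ (α : ℝ) (_ : 0 < α), α • D t ω

/-- The objective E V(S(Δz)+c), with the convention that the disutility is +∞
whenever some trading cost S_t(Δz_t) is +∞. -/
def objAlm {Ω : Type*} [MeasurableSpace Ω] {J T : ℕ} (μ : Measure Ω)
    (S : ℕ → (Fin J → ℝ) → Ω → EReal) (c : ℕ → Ω → ℝ)
    (V : (Fin (T+1) → ℝ) → Ω → EReal) (z : ℕ → Ω → Fin J → ℝ) : EReal :=
  eInt μ (fun ω =>
    if ∀ t ≤ T, S t (dz z t ω) ω ≠ ⊤ then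
      V (fun i : Fin (T+1) => (S i.val (dz z i.val ω) ω).toReal + c i.val ω) ω
    else ⊤)

section Selection

variable {Ω : Type*} {mΩ : MeasurableSpace Ω}

lemma measurable_comp_nat {β : Type*} [MeasurableSpace β] {f : ℕ → Ω → β} {n : Ω → ℕ}
    (hf : ∀ j, Measurable (f j)) (hn : Measurable n) : Measurable fun ω => f (n ω) ω := by
  have : Measurable fun p : ℕ × Ω => f p.1 p.2 := measurable_from_prod_countable_right hf
  exact this.comp (hn.prodMk measurable_id)

/-- A random subsequence along which a sequence of events is realised. -/
lemma exists_measurable_subseq (p : ℕ → ℕ → Ω → Prop)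
    (hp : ∀ k j, MeasurableSet {ω | p k j ω}) :
    ∃ n : ℕ → Ω → ℕ, (∀ k, Measurable (n k)) ∧ (∀ ω, StrictMono fun k => n k ω) ∧
      ∀ ω, (∀ k, ∃ᶠ j in atTop, p k j ω) → ∀ k, p k (n k ω) ω := by
  have hex : ∀ k b ω, ∃ j, b ≤ j ∧ (p k j ω ∨ ∀ i, b ≤ i → ¬ p k i ω) := by
    intro k b ω
    by_cases h : ∃ i, b ≤ i ∧ p k i ω
    · obtain ⟨i, hi, hpi⟩ := h
      exact ⟨i, hi, Or.inl hpi⟩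
    · push Not at h
      exact ⟨b, le_rfl, Or.inr h⟩
  let next : ℕ → ℕ → Ω → ℕ := fun k b ω => Nat.find (hex k b ω)
  have hnext : ∀ k b, Measurable (next k b) := by
    intro k b
    refine measurable_find _ fun j => ?_
    refine MeasurableSet.inter (MeasurableSet.const _) ((hp k j).union ?_)
    have : {ω | ∀ i, b ≤ i → ¬ p k i ω} = ⋂ i, ⋂ (_ : b ≤ i), {ω | p k i ω}ᶜ := by
      ext ω; simp
    change MeasurableSet {ω | ∀ i, b ≤ i → ¬ p k i ω}
    rw [this]
    exact MeasurableSet.iInter fun i => MeasurableSet.iInter fun _ => (hp k i).compl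
  have hspec : ∀ k b ω, b ≤ next k b ω ∧ (p k (next k b ω) ω ∨ ∀ i, b ≤ i → ¬ p k i ω) :=
    fun k b ω => Nat.find_spec (hex k b ω)
  let n : ℕ → Ω → ℕ := fun k => Nat.rec (fun ω => next 0 0 ω)
    (fun k r ω => next (k + 1) (r ω + 1) ω) k
  have hns : ∀ k ω, n (k + 1) ω = next (k + 1) (n k ω + 1) ω := fun _ _ => rfl
  refine ⟨n, ?_, ?_, ?_⟩
  · intro k
    induction k with
    | zero => exact hnext 0 0
    | succ k ih =>
      exact measurable_comp_nat (f := fun b ω => next (k + 1) (b + 1) ω) (fun j => hnext _ _) ih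
  · intro ω
    refine strictMono_nat_of_lt_succ fun k => ?_
    rw [hns]
    exact (hspec (k + 1) (n k ω + 1) ω).1
  · intro ω hω k
    have key : ∀ b, p k (next k b ω) ω := by
      intro b
      rcases (hspec k b ω).2 with h | h
      · exact h
      · obtain ⟨i, hi, hpi⟩ := (frequently_atTop.1 (hω k)) b
        exact absurd hpi (h i hi)
    cases k with
    | zero => exact key 0
    | succ k => exact key _

lemma exists_measurable_subseq_tendsto_real (y : ℕ → Ω → ℝ) (hy : ∀ k, Measurable (y k))
    (hb : ∀ ω, ∃ C, ∀ k, |y k ω| ≤ C) :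
    ∃ n : ℕ → Ω → ℕ, (∀ k, Measurable (n k)) ∧ (∀ ω, StrictMono fun k => n k ω) ∧
      ∀ ω, ∃ l, Tendsto (fun k => y (n k ω) ω) atTop (𝓝 l) := by
  set L : Ω → ℝ := fun ω => liminf (fun k => y k ω) atTop with hL
  have hLm : Measurable L := Measurable.liminf hy
  obtain ⟨n, hn, hmono, hsel⟩ := exists_measurable_subseq
    (fun k j ω => |y j ω - L ω| < 1 / ((k : ℝ) + 1))
    (fun k j => measurableSet_lt (by fun_prop) measurable_const)
  refine ⟨n, hn, hmono, fun ω => ⟨L ω, ?_⟩⟩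
  obtain ⟨C, hC⟩ := hb ω
  have hbd : IsBoundedUnder (· ≥ ·) atTop fun k => y k ω :=
    isBoundedUnder_of ⟨-C, fun k => (abs_le.1 (hC k)).1⟩
  have hbd' : IsBoundedUnder (· ≤ ·) atTop fun k => y k ω :=
    isBoundedUnder_of ⟨C, fun k => (abs_le.1 (hC k)).2⟩
  have hfr : ∀ k : ℕ, ∃ᶠ j in atTop, |y j ω - L ω| < 1 / ((k : ℝ) + 1) := by
    intro k
    have hpos : (0 : ℝ) < 1 / ((k : ℝ) + 1) := by positivity
    have h1 : ∃ᶠ j in atTop, y j ω < L ω + 1 / ((k : ℝ) + 1) :=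
      frequently_lt_of_liminf_lt hbd'.isCoboundedUnder_ge (by simp only [hL]; linarith)
    have h2 : ∀ᶠ j in atTop, L ω - 1 / ((k : ℝ) + 1) < y j ω :=
      eventually_lt_of_lt_liminf (by simp only [hL]; linarith) hbd
    refine (h1.and_eventually h2).mono fun j hj => ?_
    rw [abs_lt]; constructor <;> linarith [hj.1, hj.2]
  have := hsel ω hfr
  rw [tendsto_iff_dist_tendsto_zero]
  refine squeeze_zero (fun _ => dist_nonneg) (fun k => (?_ : _ ≤ 1 / ((k : ℝ) + 1)))
    tendsto_one_div_add_atTop_nhds_zero_nat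
  rw [Real.dist_eq]
  exact (this k).le

/-- Measurable version of the Bolzano-Weierstrass theorem. -/
lemma exists_measurable_subseq_tendsto {J : ℕ} (y : ℕ → Ω → Fin J → ℝ)
    (hy : ∀ k, Measurable (y k)) (hb : ∀ ω, ∃ C, ∀ k, ‖y k ω‖ ≤ C) :
    ∃ n : ℕ → Ω → ℕ, (∀ k, Measurable (n k)) ∧ (∀ ω, StrictMono fun k => n k ω) ∧
      ∃ l : Ω → Fin J → ℝ, Measurable l ∧
        ∀ ω, Tendsto (fun k => y (n k ω) ω) atTop (𝓝 (l ω)) := by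
  have key : ∀ s : Finset (Fin J), ∃ n : ℕ → Ω → ℕ, (∀ k, Measurable (n k)) ∧
      (∀ ω, StrictMono fun k => n k ω) ∧
      ∀ i ∈ s, ∀ ω, ∃ l, Tendsto (fun k => y (n k ω) ω i) atTop (𝓝 l) := by
    intro s
    induction s using Finset.induction_on with
    | empty => exact ⟨fun k _ => k, fun _ => measurable_const, fun _ => strictMono_id, by simp⟩
    | insert i s _ ih =>
      obtain ⟨n, hn, hmono, hlim⟩ := ih
      obtain ⟨m, hm, hmmono, hmlim⟩ := exists_measurable_subseq_tendsto_real
        (fun k ω => y (n k ω) ω i)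
        (fun k => (measurable_pi_apply i).comp (measurable_comp_nat hy (hn k)))
        (fun ω => by
          obtain ⟨C, hC⟩ := hb ω
          exact ⟨C, fun k => (norm_le_pi_norm (y (n k ω) ω) i).trans (hC _)⟩)
      refine ⟨fun k ω => n (m k ω) ω, fun k => measurable_comp_nat hn (hm k),
        fun ω => (hmono ω).comp (hmmono ω), fun j hj ω => ?_⟩
      rcases Finset.mem_insert.1 hj with rfl | hj
      · exact hmlim ω
      · obtain ⟨l, hl⟩ := hlim j hj ω
        exact ⟨l, hl.comp (hmmono ω).tendsto_atTop⟩
  obtain ⟨n, hn, hmono, hlim⟩ := key Finset.univ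
  choose l hl using fun ω i => hlim i (Finset.mem_univ i) ω
  have hl' : ∀ ω, Tendsto (fun k => y (n k ω) ω) atTop (𝓝 (l ω)) :=
    fun ω => tendsto_pi_nhds.2 (hl ω)
  exact ⟨n, hn, hmono, l, measurable_of_tendsto_metrizable
    (fun k => measurable_comp_nat hy (hn k)) (tendsto_pi_nhds.2 hl'), hl'⟩

end Selection

section CondExp

variable {Ω : Type*} {𝓕 𝓗 m0 : MeasurableSpace Ω} {μ : Measure Ω} [IsFiniteMeasure μ]

lemma condLExp_mul_left (h𝓕 : 𝓕 ≤ m0) {g f : Ω → ℝ≥0∞} (hg : Measurable[𝓕] g)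
    (hf : Measurable f) :
    condLExp 𝓕 μ (fun ω => g ω * f ω) =ᵐ[μ] fun ω => g ω * condLExp 𝓕 μ f ω := by
  refine (ae_eq_condLExp h𝓕 μ _ (hg.mul (measurable_condLExp 𝓕 μ f)) fun s hs => ?_).symm
  have hg0 : Measurable g := hg.mono h𝓕 le_rfl
  have hc0 : Measurable (condLExp 𝓕 μ f) := measurable_condLExp' 𝓕 μ f
  have htrim : (μ.withDensity f).trim h𝓕 = (μ.withDensity (condLExp 𝓕 μ f)).trim h𝓕 := by
    refine @Measure.ext _ 𝓕 _ _ fun t ht => ?_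
    rw [trim_measurableSet_eq h𝓕 ht, trim_measurableSet_eq h𝓕 ht,
      withDensity_apply _ (h𝓕 _ ht), withDensity_apply _ (h𝓕 _ ht), setLIntegral_condLExp h𝓕 μ f ht]
  have key : ∀ u : Ω → ℝ≥0∞, Measurable u →
      ∫⁻ ω in s, g ω * u ω ∂μ
        = ∫⁻ ω, s.indicator g ω ∂((μ.withDensity u).trim h𝓕) := by
    intro u hu
    rw [lintegral_trim h𝓕 (hg.indicator hs),
      lintegral_withDensity_eq_lintegral_mul _ hu (hg0.indicator (h𝓕 _ hs)),
      ← lintegral_indicator (h𝓕 _ hs)]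
    refine lintegral_congr fun ω => ?_
    by_cases hω : ω ∈ s <;> simp [hω, mul_comm]
  exact (key _ hc0).trans (htrim ▸ (key _ hf).symm)

lemma condLExp_condLExp (h : 𝓕 ≤ 𝓗) (h𝓗 : 𝓗 ≤ m0) (f : Ω → ℝ≥0∞) :
    condLExp 𝓕 μ (condLExp 𝓗 μ f) =ᵐ[μ] condLExp 𝓕 μ f := by
  refine ae_eq_condLExp (h.trans h𝓗) μ _ (measurable_condLExp 𝓕 μ _) fun s hs => ?_
  rw [setLIntegral_condLExp (h.trans h𝓗) μ _ hs, setLIntegral_condLExp h𝓗 μ _ (h _ hs)]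

lemma condLExp_mono_on (h𝓕 : 𝓕 ≤ m0) {A : Set Ω} (hA : MeasurableSet[𝓕] A) {f g : Ω → ℝ≥0∞}
    (hf : Measurable f) (hg : Measurable g) (hfg : ∀ᵐ ω ∂μ, ω ∈ A → f ω ≤ g ω) :
    ∀ᵐ ω ∂μ, ω ∈ A → condLExp 𝓕 μ f ω ≤ condLExp 𝓕 μ g ω := by
  have hi : Measurable[𝓕] (A.indicator fun _ => (1 : ℝ≥0∞)) :=
    (@measurable_const _ _ _ 𝓕 (1 : ℝ≥0∞)).indicator hA
  have h1 := condLExp_mul_left (μ := μ) h𝓕 hi hf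
  have h2 := condLExp_mul_left (μ := μ) h𝓕 hi hg
  have h3 : condLExp 𝓕 μ (fun ω => A.indicator (fun _ => (1 : ℝ≥0∞)) ω * f ω)
      ≤ᵐ[μ] condLExp 𝓕 μ (fun ω => A.indicator (fun _ => (1 : ℝ≥0∞)) ω * g ω) := by
    refine condLExp_mono ?_
    filter_upwards [hfg] with ω hω
    by_cases hωA : ω ∈ A <;> simp [hωA, hω]
  filter_upwards [h1, h2, h3] with ω h1 h2 h3 hω
  rw [h1, h2] at h3
  simpa [hω] using h3

lemma condLExp_congr_on (h𝓕 : 𝓕 ≤ m0) {A : Set Ω} (hA : MeasurableSet[𝓕] A) {f g : Ω → ℝ≥0∞}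
    (hf : Measurable f) (hg : Measurable g) (hfg : ∀ᵐ ω ∂μ, ω ∈ A → f ω = g ω) :
    ∀ᵐ ω ∂μ, ω ∈ A → condLExp 𝓕 μ f ω = condLExp 𝓕 μ g ω := by
  filter_upwards [condLExp_mono_on h𝓕 hA hf hg (hfg.mono fun ω h hω => (h hω).le),
    condLExp_mono_on h𝓕 hA hg hf (hfg.mono fun ω h hω => (h hω).ge)] with ω h1 h2 hω
  exact le_antisymm (h1 hω) (h2 hω)

lemma condLExp_comp_nat (h𝓕 : 𝓕 ≤ m0) {f : ℕ → Ω → ℝ≥0∞} (hf : ∀ j, Measurable (f j))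
    {n : Ω → ℕ} (hn : Measurable[𝓕] n) :
    ∀ᵐ ω ∂μ, condLExp 𝓕 μ (fun ω => f (n ω) ω) ω = condLExp 𝓕 μ (f (n ω)) ω := by
  have hfn : Measurable fun ω => f (n ω) ω := measurable_comp_nat hf (hn.mono h𝓕 le_rfl)
  have : ∀ j, ∀ᵐ ω ∂μ, ω ∈ n ⁻¹' {j} →
      condLExp 𝓕 μ (fun ω => f (n ω) ω) ω = condLExp 𝓕 μ (f j) ω := fun j =>
    condLExp_congr_on h𝓕 (hn (measurableSet_singleton j)) hfn (hf j)
      (ae_of_all _ fun ω (hω : n ω = j) => by rw [hω])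
  filter_upwards [ae_all_iff.2 this] with ω hω
  exact hω (n ω) rfl

lemma condLExp_iSup_ae_eq (h𝓕 : 𝓕 ≤ m0) {f : ℕ → Ω → ℝ≥0∞} (hf : ∀ k, Measurable (f k))
    (hmono : Monotone f) :
    condLExp 𝓕 μ (fun ω => ⨆ k, f k ω) =ᵐ[μ] fun ω => ⨆ k, condLExp 𝓕 μ (f k) ω := by
  refine (ae_eq_condLExp h𝓕 μ _
    (Measurable.iSup fun k => measurable_condLExp 𝓕 μ (f k)) fun s hs => ?_).symm
  rw [lintegral_iSup hf hmono, lintegral_iSup' (fun k => (measurable_condLExp' 𝓕 μ _).aemeasurable)]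
  · simp_rw [setLIntegral_condLExp h𝓕 μ _ hs]
  · refine ae_restrict_of_ae ?_
    have : ∀ k, ∀ᵐ ω ∂μ, condLExp 𝓕 μ (f k) ω ≤ condLExp 𝓕 μ (f (k + 1)) ω := fun k =>
      condLExp_mono (ae_of_all _ (hmono (Nat.le_succ k)))
    filter_upwards [ae_all_iff.2 this] with ω hω
    exact monotone_nat_of_le_succ hω

/-- Conditional Fatou lemma. -/
lemma condLExp_liminf_le (h𝓕 : 𝓕 ≤ m0) {f : ℕ → Ω → ℝ≥0∞} (hf : ∀ k, Measurable (f k)) :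
    condLExp 𝓕 μ (fun ω => liminf (fun k => f k ω) atTop)
      ≤ᵐ[μ] fun ω => liminf (fun k => condLExp 𝓕 μ (f k) ω) atTop := by
  have h1 := condLExp_iSup_ae_eq (μ := μ) h𝓕 (f := fun k ω => ⨅ i, f (i + k) ω)
    (fun k => Measurable.iInf fun i => hf _) (fun k l hkl ω => by
      refine le_iInf fun i => ?_
      refine (iInf_le _ (i + (l - k))).trans (le_of_eq ?_)
      congr 1; omega)
  have h2 : ∀ k i, ∀ᵐ ω ∂μ,
      condLExp 𝓕 μ (fun ω => ⨅ i, f (i + k) ω) ω ≤ condLExp 𝓕 μ (f (i + k)) ω := fun k i =>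
    condLExp_mono (ae_of_all _ fun ω => iInf_le _ i)
  filter_upwards [h1, ae_all_iff.2 fun k => ae_all_iff.2 (h2 k)] with ω h1 h2
  simp_rw [liminf_eq_iSup_iInf_of_nat'] at *
  rw [h1]
  exact iSup_mono fun k => le_iInf fun i => h2 k i

lemma ae_eq_zero_of_condLExp_eq_zero_on (h𝓕 : 𝓕 ≤ m0) {A : Set Ω} (hA : MeasurableSet[𝓕] A)
    {f : Ω → ℝ≥0∞} (hf : Measurable f) (h : ∀ᵐ ω ∂μ, ω ∈ A → condLExp 𝓕 μ f ω = 0) :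
    ∀ᵐ ω ∂μ, ω ∈ A → f ω = 0 := by
  have h1 : ∫⁻ ω in A, f ω ∂μ = 0 := by
    rw [← setLIntegral_condLExp h𝓕 μ f hA,
      lintegral_eq_zero_iff (measurable_condLExp' 𝓕 μ f), EventuallyEq,
      ae_restrict_iff' (h𝓕 _ hA)]
    exact h
  rw [lintegral_eq_zero_iff hf, EventuallyEq, ae_restrict_iff' (h𝓕 _ hA)] at h1
  exact h1

lemma ae_liminf_eq_zero_of_condLExp (h𝓕 : 𝓕 ≤ m0) {A : Set Ω} (hA : MeasurableSet[𝓕] A)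
    {f : ℕ → Ω → ℝ≥0∞} (hf : ∀ k, Measurable (f k))
    (h : ∀ᵐ ω ∂μ, ω ∈ A → liminf (fun k => condLExp 𝓕 μ (f k) ω) atTop = 0) :
    ∀ᵐ ω ∂μ, ω ∈ A → liminf (fun k => f k ω) atTop = 0 := by
  refine ae_eq_zero_of_condLExp_eq_zero_on h𝓕 hA (Measurable.liminf hf) ?_
  filter_upwards [h, condLExp_liminf_le (μ := μ) h𝓕 hf] with ω h1 h2 hω
  exact le_antisymm (h2.trans (h1 hω).le) zero_le

/-- Existence of a countable subfamily realising the essential infimum. -/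
lemma exists_seq_iInf_ae_le {ι : Type*} [Nonempty ι] (f : ι → Ω → ℝ≥0∞)
    (hf : ∀ i, Measurable (f i)) :
    ∃ s : ℕ → ι, ∀ i, ∀ᵐ ω ∂μ, ⨅ n, f (s n) ω ≤ f i ω := by
  let φ : (ℕ → ι) → ℝ≥0∞ := fun s => ∫⁻ ω, (1 + ⨅ n, f (s n) ω)⁻¹ ∂μ
  have hm : ∀ s : ℕ → ι, Measurable fun ω => (1 + ⨅ n, f (s n) ω)⁻¹ := fun s =>
    ((Measurable.iInf fun n => hf (s n)).const_add 1).inv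
  have hle : ∀ s, φ s ≤ μ univ := fun s => by
    calc φ s ≤ ∫⁻ _, 1 ∂μ := lintegral_mono fun ω => by simp
      _ = μ univ := by simp
  obtain ⟨u, -, hu, hus⟩ := exists_seq_tendsto_sSup (range_nonempty φ) (OrderTop.bddAbove (range φ))
  choose s hs using hus
  let s' : ℕ → ι := fun k => s (Nat.unpair k).1 (Nat.unpair k).2
  have hs' : ∀ j n, ∃ k, s' k = s j n := fun j n => ⟨Nat.pair j n, by simp [s']⟩
  have hmax : ∀ t, φ t ≤ φ s' := by
    intro t
    have h1 : φ t ≤ sSup (range φ) := le_sSup ⟨t, rfl⟩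
    refine h1.trans (le_of_tendsto' hu fun j => ?_)
    rw [← hs]
    refine lintegral_mono fun ω => ENNReal.inv_le_inv.2 (add_le_add le_rfl ?_)
    refine le_iInf fun n => ?_
    obtain ⟨k, hk⟩ := hs' j n
    rw [← hk]
    exact iInf_le _ k
  refine ⟨s', fun i => ?_⟩
  let t : ℕ → ι := fun k => Nat.casesOn k i s'
  have ht : ∀ ω, ⨅ n, f (t n) ω = f i ω ⊓ ⨅ n, f (s' n) ω := by
    intro ω
    refine le_antisymm (le_inf (iInf_le _ 0) (le_iInf fun n => iInf_le _ (n + 1))) ?_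
    refine le_iInf fun n => ?_
    cases n with
    | zero => exact inf_le_left
    | succ n => exact inf_le_right.trans (iInf_le _ n)
  have hpt : ∀ ω, (1 + ⨅ n, f (s' n) ω)⁻¹ ≤ (1 + ⨅ n, f (t n) ω)⁻¹ := fun ω => by
    rw [ht]; gcongr; exact inf_le_right
  have hae := ae_eq_of_ae_le_of_lintegral_le (ae_of_all μ hpt)
    ((hle s').trans_lt (measure_lt_top _ _)).ne (hm t).aemeasurable (hmax t)
  filter_upwards [hae] with ω hω
  have : (1 + ⨅ n, f (s' n) ω) = 1 + ⨅ n, f (t n) ω := inv_injective hω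
  rw [ENNReal.add_right_inj ENNReal.one_ne_top, ht] at this
  rw [this]
  exact inf_le_left

end CondExp

section AbstractExistence

open scoped NNReal

variable {Ω : Type*} {J : ℕ}

/-- The process `ω ↦ H (z(ω), ω)` obtained by evaluating an integrand along a process. -/
def along (H : (ℕ → Fin J → ℝ) → Ω → ℝ≥0∞) (z : ℕ → Ω → Fin J → ℝ) (ω : Ω) : ℝ≥0∞ :=
  H (fun s => z s ω) ω

/-- `z s` is known at time `max s t`: the process is adapted once the information available
at time `t` is disclosed at the start. -/
def AdaptedFrom (𝓖 : ℕ → MeasurableSpace Ω) (t : ℕ) (z : ℕ → Ω → Fin J → ℝ) : Prop :=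
  ∀ s, Measurable[𝓖 (max s t)] (z s)

section Adapted

variable {𝓖 : ℕ → MeasurableSpace Ω} {t : ℕ}

lemma AdaptedFrom.comp_nat (hmono : Monotone 𝓖) {z : ℕ → ℕ → Ω → Fin J → ℝ}
    (hz : ∀ j, AdaptedFrom 𝓖 t (z j)) {n : Ω → ℕ} (hn : Measurable[𝓖 t] n) :
    AdaptedFrom 𝓖 t fun s ω => z (n ω) s ω := fun s =>
  measurable_comp_nat (mΩ := 𝓖 (max s t)) (f := fun j => z j s) (fun j => hz j s)
    (hn.mono (hmono (le_max_right s t)) le_rfl)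

lemma AdaptedFrom.measurable_self {z : ℕ → Ω → Fin J → ℝ} (hz : AdaptedFrom 𝓖 t z) {s : ℕ}
    (hs : s ≤ t) : Measurable[𝓖 t] (z s) := by
  have := hz s
  rwa [max_eq_right hs] at this

lemma AdaptedFrom.succ (hmono : Monotone 𝓖) {z : ℕ → Ω → Fin J → ℝ}
    (hz : AdaptedFrom 𝓖 t z) : AdaptedFrom 𝓖 (t + 1) z := fun s =>
  (hz s).mono (hmono (max_le_max le_rfl (Nat.le_succ t))) le_rfl

lemma AdaptedFrom.measurable_of_tendsto_smul {z : ℕ → ℕ → Ω → Fin J → ℝ} {ρ : ℕ → Ω → ℝ≥0}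
    {x : ℕ → Ω → Fin J → ℝ} (hz : ∀ k, AdaptedFrom 𝓖 t (z k))
    (hρ : ∀ k, Measurable[𝓖 t] (ρ k)) {s : ℕ} (hs : s ≤ t)
    (hx : ∀ ω, Tendsto (fun k => ρ k ω • z k s ω) atTop (𝓝 (x s ω))) :
    Measurable[𝓖 t] (x s) :=
  @measurable_of_tendsto_metrizable _ _ (𝓖 t) _ _ _ _ (fun k ω => ρ k ω • z k s ω) _
    (fun k => (hρ k).smul ((hz k).measurable_self hs)) (tendsto_pi_nhds.2 hx)

end Adapted

/-- Nonnegative lower semicontinuous integrands on paths of length `N`, with a cone-valued map `R`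
of directions in which they do not increase and which contains all directions of sublinear growth;
the adapted selections of `R` are symmetric. -/
structure RecessionIntegrand [m0 : MeasurableSpace Ω] (μ : Measure Ω)
    (𝓖 : ℕ → MeasurableSpace Ω) (N : ℕ) (H : (ℕ → Fin J → ℝ) → Ω → ℝ≥0∞)
    (R : Ω → Set (ℕ → Fin J → ℝ)) : Prop where
  mono : Monotone 𝓖
  le : ∀ t, 𝓖 t ≤ m0
  top : 𝓖 N = m0
  meas : ∀ z : ℕ → Ω → Fin J → ℝ, (∀ s, Measurable (z s)) → Measurable (along H z)
  lsc : ∀ ω (y : ℕ → ℕ → Fin J → ℝ) (x : ℕ → Fin J → ℝ),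
    (∀ s < N, Tendsto (fun k => y k s) atTop (𝓝 (x s))) →
    H x ω ≤ liminf (fun k => H (y k) ω) atTop
  recession : ∀ ω (ρ : ℕ → ℝ≥0) (y : ℕ → ℕ → Fin J → ℝ) (w : ℕ → Fin J → ℝ),
    Tendsto ρ atTop (𝓝 0) → (∀ s < N, Tendsto (fun k => ρ k • y k s) atTop (𝓝 (w s))) →
    liminf (fun k => (ρ k : ℝ≥0∞) * H (y k) ω) atTop = 0 → w ∈ R ω
  add_le : ∀ ω x w, w ∈ R ω → H (x + w) ω ≤ H x ω
  smul_mem : ∀ ω w (a : ℝ≥0), w ∈ R ω → a • w ∈ R ω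
  neg_mem : ∀ w : ℕ → Ω → Fin J → ℝ, (∀ s, Measurable[𝓖 s] (w s)) →
    (∀ᵐ ω ∂μ, (fun s => w s ω) ∈ R ω) → ∀ᵐ ω ∂μ, -(fun s => w s ω) ∈ R ω

variable [m0 : MeasurableSpace Ω] {μ : Measure Ω} {𝓖 : ℕ → MeasurableSpace Ω} {N : ℕ}
  {H : (ℕ → Fin J → ℝ) → Ω → ℝ≥0∞} {R : Ω → Set (ℕ → Fin J → ℝ)} {t : ℕ}

namespace RecessionIntegrand

lemma measurable_along (hH : RecessionIntegrand μ 𝓖 N H R) {z : ℕ → Ω → Fin J → ℝ}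
    (hz : AdaptedFrom 𝓖 t z) : Measurable (along H z) :=
  hH.meas z fun s => (hz s).mono (hH.le _) le_rfl

variable [IsFiniteMeasure μ]

lemma condLExp_along_comp_nat (hH : RecessionIntegrand μ 𝓖 N H R)
    {z : ℕ → ℕ → Ω → Fin J → ℝ} (hz : ∀ j, AdaptedFrom 𝓖 t (z j)) {n : Ω → ℕ}
    (hn : Measurable[𝓖 t] n) :
    ∀ᵐ ω ∂μ, condLExp (𝓖 t) μ (along H fun s ω => z (n ω) s ω) ω
      = condLExp (𝓖 t) μ (along H (z (n ω))) ω :=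
  condLExp_comp_nat (hH.le t) (f := fun j => along H (z j))
    (fun j => hH.measurable_along (hz j)) hn

/-- Among the continuations which do not increase the conditional cost, one can choose one whose
next position has nearly minimal norm. -/
lemma exists_nearMin (hH : RecessionIntegrand μ 𝓖 N H R) {z : ℕ → Ω → Fin J → ℝ}
    (hz : AdaptedFrom 𝓖 t z) :
    ∃ y : ℕ → Ω → Fin J → ℝ, AdaptedFrom 𝓖 t y ∧ (∀ s < t, y s = z s) ∧
      condLExp (𝓖 t) μ (along H y) ≤ᵐ[μ] condLExp (𝓖 t) μ (along H z) ∧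
      ∀ y' : ℕ → Ω → Fin J → ℝ, AdaptedFrom 𝓖 t y' → (∀ s < t, y' s = y s) →
        along H y' ≤ᵐ[μ] along H y → ∀ᵐ ω ∂μ, ‖y t ω‖ ≤ ‖y' t ω‖ + 1 := by
  let ι := {y : ℕ → Ω → Fin J → ℝ // AdaptedFrom 𝓖 t y ∧ (∀ s < t, y s = z s) ∧
      condLExp (𝓖 t) μ (along H y) ≤ᵐ[μ] condLExp (𝓖 t) μ (along H z)}
  have : Nonempty ι := ⟨⟨z, hz, fun _ _ => rfl, EventuallyLE.rfl⟩⟩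
  have hfm : ∀ i : ι, Measurable[𝓖 t] fun ω => ‖i.1 t ω‖ₑ := fun i =>
    measurable_enorm.comp (i.2.1.measurable_self le_rfl)
  obtain ⟨u, hu⟩ := exists_seq_iInf_ae_le (μ := μ) (fun (i : ι) ω => ‖i.1 t ω‖ₑ)
    (fun i => (hfm i).mono (hH.le t) le_rfl)
  have hgt : ∀ ω, ⨅ n, ‖(u n).1 t ω‖ₑ ≠ ⊤ := fun ω =>
    ((iInf_le _ 0).trans_lt (enorm_lt_top (x := (u 0).1 t ω))).ne
  have hex : ∀ ω, ∃ j, ‖(u j).1 t ω‖ₑ ≤ (⨅ n, ‖(u n).1 t ω‖ₑ) + 1 := by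
    intro ω
    obtain ⟨j, hj⟩ := iInf_lt_iff.1 (ENNReal.lt_add_right (hgt ω) one_ne_zero)
    exact ⟨j, hj.le⟩
  let τ : Ω → ℕ := fun ω => Nat.find (hex ω)
  have hτ : Measurable[𝓖 t] τ := by
    refine @measurable_find _ (𝓖 t) _ _ hex fun j => ?_
    exact measurableSet_le (mδ := 𝓖 t) (hfm _)
      ((Measurable.iInf (mδ := 𝓖 t) fun n => hfm (u n)).add_const 1)
  have hya : AdaptedFrom 𝓖 t fun s ω => (u (τ ω)).1 s ω :=
    AdaptedFrom.comp_nat hH.mono (z := fun j => (u j).1) (fun j => (u j).2.1) hτ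
  have hyz : ∀ s < t, (fun ω => (u (τ ω)).1 s ω) = z s := by
    intro s hs
    funext ω
    rw [(u (τ ω)).2.2.1 s hs]
  have hyE : condLExp (𝓖 t) μ (along H fun s ω => (u (τ ω)).1 s ω)
      ≤ᵐ[μ] condLExp (𝓖 t) μ (along H z) := by
    filter_upwards [hH.condLExp_along_comp_nat (z := fun j => (u j).1) (fun j => (u j).2.1) hτ,
      ae_all_iff.2 fun j => (u j).2.2.2] with ω h1 h2
    rw [h1]
    exact h2 (τ ω)
  refine ⟨fun s ω => (u (τ ω)).1 s ω, hya, hyz, hyE, fun y' hy' hy's hy'H => ?_⟩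
  let i : ι := ⟨y', hy', fun s hs => (hy's s hs).trans (hyz s hs),
    (condLExp_mono hy'H).trans hyE⟩
  filter_upwards [hu i] with ω hω
  have h1 : ‖(u (τ ω)).1 t ω‖ₑ ≤ ‖y' t ω‖ₑ + 1 :=
    (Nat.find_spec (hex ω)).trans (add_le_add hω le_rfl)
  rw [enorm_eq_nnnorm, enorm_eq_nnnorm] at h1
  exact_mod_cast h1

/-- Compactness property of sequences of scaled processes whose positions before time `t`
converge: on `G` it yields lower semicontinuity of the conditional cost and off `G` limiting
directions belong to `R`. -/
def ClosedAt (μ : Measure Ω) (𝓖 : ℕ → MeasurableSpace Ω) (H : (ℕ → Fin J → ℝ) → Ω → ℝ≥0∞)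
    (R : Ω → Set (ℕ → Fin J → ℝ)) (t : ℕ) : Prop :=
  ∀ (z : ℕ → ℕ → Ω → Fin J → ℝ) (ρ : ℕ → Ω → ℝ≥0) (x : ℕ → Ω → Fin J → ℝ) (G : Set Ω),
    (∀ k, AdaptedFrom 𝓖 t (z k)) → (∀ k, Measurable[𝓖 t] (ρ k)) → MeasurableSet[𝓖 t] G →
    (∀ ω ∈ G, ∀ k, ρ k ω = 1) → (∀ ω ∉ G, Tendsto (fun k => ρ k ω) atTop (𝓝 0)) →
    (∀ s < t, ∀ ω, Tendsto (fun k => ρ k ω • z k s ω) atTop (𝓝 (x s ω))) →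
    (∀ᵐ ω ∂μ, ω ∉ G →
      liminf (fun k => (ρ k ω : ℝ≥0∞) * condLExp (𝓖 t) μ (along H (z k)) ω) atTop = 0) →
    ∃ y : ℕ → Ω → Fin J → ℝ, AdaptedFrom 𝓖 t y ∧ (∀ s < t, y s = x s) ∧
      (∀ᵐ ω ∂μ, ω ∈ G → condLExp (𝓖 t) μ (along H y) ω ≤
        liminf (fun k => (ρ k ω : ℝ≥0∞) * condLExp (𝓖 t) μ (along H (z k)) ω) atTop) ∧
      ∀ᵐ ω ∂μ, ω ∉ G → (fun s => y s ω) ∈ R ω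

lemma closedAt_top (hH : RecessionIntegrand μ 𝓖 N H R) : ClosedAt μ 𝓖 H R N := by
  intro z ρ x G hz hρ hG hρ1 hρ0 hx hlim
  have hself : ∀ y, AdaptedFrom 𝓖 N y → condLExp (𝓖 N) μ (along H y) = along H y := fun y hy =>
    condLExp_eq_self (hH.le N) μ (by
      have := hH.measurable_along hy
      rwa [← hH.top] at this)
  have hxm : ∀ s < N, Measurable[𝓖 N] (x s) := fun s hs =>
    AdaptedFrom.measurable_of_tendsto_smul hz hρ hs.le (hx s hs)
  have hy : AdaptedFrom 𝓖 N fun s ω => if s < N then x s ω else 0 := by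
    intro s
    by_cases hs : s < N
    · simpa only [hs, if_true] using (hxm s hs).mono (hH.mono (le_max_right s N)) le_rfl
    · simp [hs]
  refine ⟨_, hy, fun s hs => by simp [hs], ?_, ?_⟩
  · refine ae_of_all _ fun ω hω => ?_
    rw [hself _ hy]
    simp only [hself _ (hz _), hρ1 ω hω, ENNReal.coe_one, one_mul]
    refine hH.lsc ω _ _ fun s hs => ?_
    simpa [hs, hρ1 ω hω] using hx s hs ω
  · filter_upwards [hlim] with ω hω hωG
    refine hH.recession ω (fun k => ρ k ω) (fun k s => z k s ω) _ (hρ0 ω hωG)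
      (fun s hs => ?_) ?_
    · simpa [hs] using hx s hs ω
    · simp only [hself _ (hz _)] at hω
      exact hω hωG

lemma condLExp_mul_condLExp_succ (hH : RecessionIntegrand μ 𝓖 N H R)
    {σ : Ω → ℝ≥0} (hσ : Measurable[𝓖 t] σ) (z : ℕ → Ω → Fin J → ℝ) :
    condLExp (𝓖 t) μ (fun ω => (σ ω : ℝ≥0∞) * condLExp (𝓖 (t + 1)) μ (along H z) ω)
      =ᵐ[μ] fun ω => (σ ω : ℝ≥0∞) * condLExp (𝓖 t) μ (along H z) ω := by
  filter_upwards [condLExp_mul_left (μ := μ) (hH.le t) hσ.coe_nnreal_ennreal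
    (measurable_condLExp' (𝓖 (t + 1)) μ (along H z)),
    condLExp_condLExp (μ := μ) (hH.mono (Nat.le_succ t)) (hH.le (t + 1)) (along H z)]
    with ω h1 h2
  rw [h1, h2]

lemma ae_liminf_succ_eq_zero (hH : RecessionIntegrand μ 𝓖 N H R)
    {z : ℕ → ℕ → Ω → Fin J → ℝ} {σ : ℕ → Ω → ℝ≥0} {A : Set Ω} (hA : MeasurableSet[𝓖 t] A)
    (hσ : ∀ k, Measurable[𝓖 t] (σ k))
    (h : ∀ᵐ ω ∂μ, ω ∈ A →
      liminf (fun k => (σ k ω : ℝ≥0∞) * condLExp (𝓖 t) μ (along H (z k)) ω) atTop = 0) :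
    ∀ᵐ ω ∂μ, ω ∈ A →
      liminf (fun k => (σ k ω : ℝ≥0∞) * condLExp (𝓖 (t + 1)) μ (along H (z k)) ω) atTop = 0 := by
  refine ae_liminf_eq_zero_of_condLExp (hH.le t) hA (fun k =>
    ((hσ k).mono (hH.le t) le_rfl).coe_nnreal_ennreal.mul
      (measurable_condLExp' (𝓖 (t + 1)) μ (along H (z k)))) ?_
  filter_upwards [h, ae_all_iff.2 fun k => hH.condLExp_mul_condLExp_succ (hσ k) (z k)]
    with ω h1 h2 hω
  simp_rw [h2]
  exact h1 hω

lemma nnnorm_nnreal_smul {E : Type*} [SeminormedAddCommGroup E] [NormedSpace ℝ E] (c : ℝ≥0)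
    (x : E) : ‖c • x‖₊ = c * ‖x‖₊ := by
  rw [NNReal.smul_def, nnnorm_smul, NNReal.nnnorm_eq]

lemma tendsto_zero_of_le_inv_mul {a : ℕ → ℝ≥0∞} {C : ℝ≥0∞} (hC : C ≠ ⊤)
    (h : ∀ k : ℕ, a k ≤ ((k : ℝ≥0) + 1)⁻¹ * C) : Tendsto a atTop (𝓝 0) := by
  have h1 : Tendsto (fun k : ℕ => ((k : ℝ≥0) + 1)⁻¹) atTop (𝓝 0) := by
    rw [← NNReal.tendsto_coe]
    simpa using tendsto_one_div_add_atTop_nhds_zero_nat (𝕜 := ℝ)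
  have h2 := ENNReal.Tendsto.mul_const (b := C) (ENNReal.tendsto_coe.2 h1) (Or.inr hC)
  rw [ENNReal.coe_zero, zero_mul] at h2
  refine tendsto_of_tendsto_of_tendsto_of_le_of_le tendsto_const_nhds h2 (fun _ => zero_le)
    fun k => ?_
  simpa using h k

/-- Scaled processes with bounded conditional cost and nearly minimal norm at time `t` are bounded
at time `t`. -/
lemma ae_bounded_of_nearMin (hH : RecessionIntegrand μ 𝓖 N H R) (hc : ClosedAt μ 𝓖 H R (t + 1))
    {z : ℕ → ℕ → Ω → Fin J → ℝ} (hz : ∀ k, AdaptedFrom 𝓖 t (z k))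
    (hmin : ∀ k, ∀ y' : ℕ → Ω → Fin J → ℝ, AdaptedFrom 𝓖 t y' → (∀ s < t, y' s = z k s) →
      along H y' ≤ᵐ[μ] along H (z k) → ∀ᵐ ω ∂μ, ‖z k t ω‖ ≤ ‖y' t ω‖ + 1)
    {ρ : ℕ → Ω → ℝ≥0} (hρ : ∀ k, Measurable[𝓖 t] (ρ k)) (hρb : ∀ ω, ∃ C, ∀ k, ρ k ω ≤ C)
    (hzb : ∀ s < t, ∀ ω, ∃ C, ∀ k, ρ k ω * ‖z k s ω‖₊ ≤ C)
    {ℓ : Ω → ℝ≥0∞} (hℓ : Measurable[𝓖 t] ℓ)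
    (hE : ∀ᵐ ω ∂μ, ∀ k, (ρ k ω : ℝ≥0∞) * condLExp (𝓖 t) μ (along H (z k)) ω ≤ ℓ ω + 1) :
    ∀ᵐ ω ∂μ, ℓ ω ≠ ⊤ → ∃ C : ℕ, ∀ k, ρ k ω * ‖z k t ω‖₊ ≤ C := by
  have hzt : ∀ k, Measurable[𝓖 t] (z k t) := fun k => (hz k).measurable_self le_rfl
  have hgm : ∀ k, Measurable[𝓖 t] fun ω => ρ k ω * ‖z k t ω‖₊ := fun k =>
    (hρ k).mul (measurable_nnnorm.comp (hzt k))
  let B : Set Ω := {ω | ℓ ω ≠ ⊤ ∧ ∀ C : ℕ, ∃ k, (C : ℝ≥0) < ρ k ω * ‖z k t ω‖₊}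
  have hB : MeasurableSet[𝓖 t] B := by
    have h1 : MeasurableSet[𝓖 t] {ω | ℓ ω ≠ ⊤} := hℓ (measurableSet_singleton ⊤).compl
    have h2 : MeasurableSet[𝓖 t]
        (⋂ C : ℕ, ⋃ k, {ω | (C : ℝ≥0) < ρ k ω * ‖z k t ω‖₊}) :=
      MeasurableSet.iInter fun C => MeasurableSet.iUnion fun k =>
        measurableSet_lt (mδ := 𝓖 t) measurable_const (hgm k)
    convert h1.inter h2 using 1
    ext ω
    simp [B]
  have hex : ∀ (k : ℕ) ω, ∃ j, ω ∈ B → (k : ℝ≥0) + 1 < ρ j ω * ‖z j t ω‖₊ := by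
    intro k ω
    by_cases hω : ω ∈ B
    · obtain ⟨j, hj⟩ := hω.2 (k + 1)
      exact ⟨j, fun _ => by exact_mod_cast hj⟩
    · exact ⟨0, fun h => absurd h hω⟩
  let n : ℕ → Ω → ℕ := fun k ω => Nat.find (hex k ω)
  have hn : ∀ k, Measurable[𝓖 t] (n k) := fun k => by
    refine @measurable_find _ (𝓖 t) _ _ (hex k) fun j => ?_
    have h1 : MeasurableSet[𝓖 t] {ω | (k : ℝ≥0) + 1 < ρ j ω * ‖z j t ω‖₊} :=
      measurableSet_lt (mδ := 𝓖 t) measurable_const (hgm j)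
    convert hB.compl.union h1 using 1
    ext ω
    simp [imp_iff_not_or]
  let v : ℕ → Ω → Fin J → ℝ := fun k =>
    B.indicator fun ω => ‖z (n k ω) t ω‖₊⁻¹ • z (n k ω) t ω
  have hv : ∀ k, Measurable[𝓖 t] (v k) := fun k => by
    have h1 : Measurable[𝓖 t] fun ω => z (n k ω) t ω :=
      measurable_comp_nat (mΩ := 𝓖 t) (f := fun j => z j t) hzt (hn k)
    exact ((measurable_nnnorm.comp h1).inv.smul h1).indicator hB
  have hv1 : ∀ k ω, ‖v k ω‖ ≤ 1 := by
    intro k ω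
    by_cases hω : ω ∈ B
    · simp only [v, indicator_of_mem hω, NNReal.smul_def, norm_smul, NNReal.coe_inv, coe_nnnorm,
        norm_inv, norm_norm]
      exact inv_mul_le_one
    · simp [v, indicator_of_notMem hω]
  obtain ⟨m, hm, hmono, u, hu, hlim⟩ := exists_measurable_subseq_tendsto (mΩ := 𝓖 t) v hv
    fun ω => ⟨1, fun k => hv1 k ω⟩
  let K : ℕ → Ω → ℕ := fun k ω => n (m k ω) ω
  have hK : ∀ k, Measurable[𝓖 t] (K k) := fun k => measurable_comp_nat (mΩ := 𝓖 t) hn (hm k)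
  have hKB : ∀ k : ℕ, ∀ ω ∈ B, (k : ℝ≥0) + 1 ≤ ρ (K k ω) ω * ‖z (K k ω) t ω‖₊ := by
    intro k ω hω
    refine le_trans ?_ (Nat.find_spec (hex (m k ω) ω) hω).le
    gcongr
    exact (hmono ω).le_apply
  let z' : ℕ → ℕ → Ω → Fin J → ℝ := fun k s ω => z (K k ω) s ω
  have hz' : ∀ k, AdaptedFrom 𝓖 t (z' k) := fun k => AdaptedFrom.comp_nat hH.mono hz (hK k)
  let σ : ℕ → Ω → ℝ≥0 := fun k => B.indicator fun ω => ‖z' k t ω‖₊⁻¹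
  have hσ : ∀ k, Measurable[𝓖 t] (σ k) := fun k =>
    ((measurable_nnnorm.comp ((hz' k).measurable_self le_rfl)).inv).indicator hB
  have hσle : ∀ k ω, σ k ω ≤ ((k : ℝ≥0) + 1)⁻¹ * ρ (K k ω) ω := by
    intro k ω
    by_cases hω : ω ∈ B
    · have h1 := hKB k ω hω
      have h2 : 0 < ‖z (K k ω) t ω‖₊ := by
        rw [pos_iff_ne_zero]
        intro h0
        rw [h0, mul_zero] at h1
        exact absurd h1 (by simp)
      simp only [σ, z', indicator_of_mem hω]
      rw [← div_eq_inv_mul, le_div_iff₀ (by positivity), inv_mul_le_iff₀ h2, mul_comm _ (ρ _ _)]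
      exact h1
    · simp [σ, indicator_of_notMem hω]
  have hnn : ∀ {a : ℕ → ℝ≥0} {C : ℝ≥0}, (∀ k : ℕ, a k ≤ ((k : ℝ≥0) + 1)⁻¹ * C) →
      Tendsto a atTop (𝓝 0) := by
    intro a C h
    rw [← ENNReal.tendsto_coe, ENNReal.coe_zero]
    exact tendsto_zero_of_le_inv_mul (C := C) ENNReal.coe_ne_top fun k => by exact_mod_cast h k
  have hσ0 : ∀ ω, Tendsto (fun k => σ k ω) atTop (𝓝 0) := by
    intro ω
    obtain ⟨C, hC⟩ := hρb ω
    exact hnn (C := C) fun k => (hσle k ω).trans (by gcongr; exact hC _)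
  have hσz : ∀ s < t, ∀ ω, Tendsto (fun k => σ k ω • z' k s ω) atTop (𝓝 0) := by
    intro s hs ω
    obtain ⟨C, hC⟩ := hzb s hs ω
    rw [tendsto_zero_iff_norm_tendsto_zero]
    have := hnn (a := fun k => ‖σ k ω • z' k s ω‖₊) (C := C) fun k => by
      rw [nnnorm_nnreal_smul]
      calc σ k ω * ‖z' k s ω‖₊ ≤ ((k : ℝ≥0) + 1)⁻¹ * ρ (K k ω) ω * ‖z' k s ω‖₊ := by
            gcongr; exact hσle k ω
        _ ≤ _ := by rw [mul_assoc]; gcongr; exact hC _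
    exact (NNReal.tendsto_coe.2 this)
  have hσt : ∀ k ω, σ k ω • z' k t ω = v (m k ω) ω := by
    intro k ω
    by_cases hω : ω ∈ B
    · simp [σ, v, z', K, indicator_of_mem hω]
    · simp [σ, v, indicator_of_notMem hω]
  have hE0 : ∀ᵐ ω ∂μ, ω ∈ univ →
      liminf (fun k => (σ k ω : ℝ≥0∞) * condLExp (𝓖 t) μ (along H (z' k)) ω) atTop = 0 := by
    filter_upwards [hE, ae_all_iff.2 fun k => hH.condLExp_along_comp_nat hz (hK k)]
      with ω h1 h2 _
    by_cases hω : ω ∈ B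
    · refine (tendsto_zero_of_le_inv_mul (C := ℓ ω + 1)
        (ENNReal.add_ne_top.2 ⟨hω.1, ENNReal.one_ne_top⟩) fun k => ?_).liminf_eq
      rw [h2 k]
      calc (σ k ω : ℝ≥0∞) * _ ≤ (((k : ℝ≥0) + 1)⁻¹ * ρ (K k ω) ω : ℝ≥0) * _ := by
            gcongr; exact hσle k ω
        _ ≤ _ := by
            rw [ENNReal.coe_mul, mul_assoc]
            gcongr
            exact h1 _
    · simp [σ, indicator_of_notMem hω]
  have hσx : ∀ s < t + 1, ∀ ω,
      Tendsto (fun k => σ k ω • z' k s ω) atTop (𝓝 ((if s = t then u else 0) ω)) := by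
    intro s hs ω
    rcases Nat.lt_succ_iff_lt_or_eq.1 hs with h | rfl
    · simpa [h.ne] using hσz s h ω
    · simpa [hσt] using hlim ω
  obtain ⟨w, hw, hwx, -, hwR⟩ := hc z' σ (fun s => if s = t then u else 0) ∅
    (fun k => (hz' k).succ hH.mono)
    (fun k => (hσ k).mono (hH.mono t.le_succ) le_rfl) (@MeasurableSet.empty _ (𝓖 (t + 1)))
    (fun _ h => h.elim)
    (fun ω _ => hσ0 ω) hσx
    ((hH.ae_liminf_succ_eq_zero (@MeasurableSet.univ _ (𝓖 t)) hσ hE0).mono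
      fun ω h _ => h (mem_univ ω))
  have hwt : w t = u := by simpa using hwx t t.lt_succ_self
  have hws : ∀ s < t, w s = 0 := fun s hs => by simpa [hs.ne] using hwx s (hs.trans t.lt_succ_self)
  have hwm : ∀ s, Measurable[𝓖 s] (w s) := by
    intro s
    rcases lt_trichotomy s t with h | rfl | h
    · rw [hws s h]; exact measurable_const
    · rw [hwt]; exact hu
    · have := hw s
      rwa [max_eq_left (Nat.succ_le_of_lt h)] at this
  have hneg := hH.neg_mem w hwm (hwR.mono fun ω h => h (notMem_empty ω))
  have hall : ∀ j, ∀ᵐ ω ∂μ, ‖z j t ω‖ ≤ ‖z j t ω + ‖z j t ω‖₊ • (-u ω)‖ + 1 := by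
    intro j
    have := hmin j (fun s ω => z j s ω + ‖z j t ω‖₊ • (-w s ω)) (fun s => ?_) (fun s hs => ?_) ?_
    · simpa only [hwt] using this
    · exact (hz j s).add (((measurable_nnnorm.comp (hzt j)).mono
        (hH.mono (le_max_right s t)) le_rfl).smul
        ((hwm s).mono (hH.mono (le_max_left s t)) le_rfl).neg)
    · funext ω
      simp [hws s hs]
    · filter_upwards [hneg] with ω hω
      exact hH.add_le ω _ _ (hH.smul_mem ω _ ‖z j t ω‖₊ hω)
  filter_upwards [ae_all_iff.2 hall] with ω hω hℓω
  by_contra hcon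
  push Not at hcon
  have hωB : ω ∈ B := ⟨hℓω, hcon⟩
  have hle : ∀ k, 1 ≤ ‖v (m k ω) ω - u ω‖ + σ k ω := by
    intro k
    have h1 := hω (K k ω)
    have h2 : 0 < ‖z (K k ω) t ω‖ := by
      have h3 := hKB k ω hωB
      rw [norm_pos_iff]
      intro h0
      rw [h0, nnnorm_zero, mul_zero] at h3
      exact absurd h3 (by simp)
    rw [← hσt]
    have h4 : σ k ω = ‖z (K k ω) t ω‖₊⁻¹ := by simp [σ, z', indicator_of_mem hωB]
    have h5 : z (K k ω) t ω + ‖z (K k ω) t ω‖₊ • (-u ω)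
        = ‖z (K k ω) t ω‖ • (σ k ω • z' k t ω - u ω) := by
      rw [h4, NNReal.smul_def, NNReal.smul_def, smul_sub, smul_smul, NNReal.coe_inv, coe_nnnorm,
        mul_inv_cancel₀ h2.ne', one_smul, smul_neg, sub_eq_add_neg]
    rw [h5, norm_smul, norm_norm] at h1
    rw [h4, NNReal.coe_inv, coe_nnnorm]
    have h6 := mul_le_mul_of_nonneg_left h1 (inv_pos.2 h2).le
    rw [inv_mul_cancel₀ h2.ne', mul_add, ← mul_assoc, inv_mul_cancel₀ h2.ne', h4] at h6
    linarith
  have hl : Tendsto (fun k => ‖v (m k ω) ω - u ω‖ + σ k ω) atTop (𝓝 (0 + 0)) :=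
    (tendsto_iff_norm_sub_tendsto_zero.1 (hlim ω)).add (NNReal.tendsto_coe.2 (hσ0 ω))
  have := ge_of_tendsto' hl hle
  norm_num at this

lemma tendsto_add_inv_nat (a : ℝ≥0∞) :
    Tendsto (fun k : ℕ => a + ((k : ℝ≥0∞) + 1)⁻¹) atTop (𝓝 a) := by
  have h1 : Tendsto (fun k : ℕ => ((k : ℝ≥0∞) + 1)⁻¹) atTop (𝓝 0) := by
    have := (ENNReal.tendsto_inv_nat_nhds_zero).comp (tendsto_add_atTop_nat 1)
    simpa [Function.comp_def] using this
  simpa using tendsto_const_nhds.add h1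

lemma closedAt_of_succ (hH : RecessionIntegrand μ 𝓖 N H R) (hc : ClosedAt μ 𝓖 H R (t + 1)) :
    ClosedAt μ 𝓖 H R t := by
  intro z ρ x G hz hρ hG hρ1 hρ0 hx hlim
  let E : (ℕ → Ω → Fin J → ℝ) → Ω → ℝ≥0∞ := fun z => condLExp (𝓖 t) μ (along H z)
  have hEm : ∀ z, Measurable[𝓖 t] (E z) := fun z => measurable_condLExp (𝓖 t) μ (along H z)
  let ℓ : Ω → ℝ≥0∞ := fun ω => liminf (fun k => (ρ k ω : ℝ≥0∞) * E (z k) ω) atTop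
  have hρE : ∀ k, Measurable[𝓖 t] fun ω => (ρ k ω : ℝ≥0∞) * E (z k) ω := fun k =>
    (hρ k).coe_nnreal_ennreal.mul (hEm _)
  have hℓ : Measurable[𝓖 t] ℓ := Measurable.liminf (mδ := 𝓖 t) hρE
  obtain ⟨n, hn, hnmono, hnp⟩ := exists_measurable_subseq (mΩ := 𝓖 t)
    (fun k j ω => ℓ ω ≠ ⊤ → (ρ j ω : ℝ≥0∞) * E (z j) ω ≤ ℓ ω + ((k : ℝ≥0∞) + 1)⁻¹)
    (fun k j => by
      have h1 : MeasurableSet[𝓖 t] {ω | (ρ j ω : ℝ≥0∞) * E (z j) ω ≤ ℓ ω + ((k : ℝ≥0∞) + 1)⁻¹} :=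
        measurableSet_le (mδ := 𝓖 t) (hρE j) (hℓ.add_const _)
      convert (hℓ (measurableSet_singleton ⊤)).union h1 using 1
      ext ω
      simp [imp_iff_not_or])
  have hnE : ∀ ω, ℓ ω ≠ ⊤ → ∀ k, (ρ (n k ω) ω : ℝ≥0∞) * E (z (n k ω)) ω
      ≤ ℓ ω + ((k : ℝ≥0∞) + 1)⁻¹ := by
    intro ω hω k
    refine hnp ω (fun k => ?_) k hω
    have h1 : ℓ ω < ℓ ω + ((k : ℝ≥0∞) + 1)⁻¹ := ENNReal.lt_add_right hω (by simp)
    exact (frequently_lt_of_liminf_lt (by isBoundedDefault) h1).mono fun j hj _ => hj.le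
  let ρ1 : ℕ → Ω → ℝ≥0 := fun k ω => ρ (n k ω) ω
  have hρ1m : ∀ k, Measurable[𝓖 t] (ρ1 k) := fun k => measurable_comp_nat (mΩ := 𝓖 t) hρ (hn k)
  have hz1 : ∀ k, AdaptedFrom 𝓖 t fun s ω => z (n k ω) s ω := fun k =>
    AdaptedFrom.comp_nat hH.mono hz (hn k)
  choose z2 hz2 hz2s hz2E hz2min using fun k => hH.exists_nearMin (hz1 k)
  have hE2 : ∀ᵐ ω ∂μ, ∀ k, (ρ1 k ω : ℝ≥0∞) * E (z2 k) ω ≤ ℓ ω + ((k : ℝ≥0∞) + 1)⁻¹ := by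
    filter_upwards [ae_all_iff.2 hz2E, ae_all_iff.2 fun k => hH.condLExp_along_comp_nat hz (hn k)]
      with ω h1 h2 k
    by_cases hω : ℓ ω = ⊤
    · simp [hω]
    · refine le_trans ?_ (hnE ω hω k)
      gcongr
      exact (h1 k).trans (h2 k).le
  have hnt : ∀ ω, Tendsto (fun k => n k ω) atTop atTop := fun ω => (hnmono ω).tendsto_atTop
  have hx2 : ∀ s < t, ∀ ω, Tendsto (fun k => ρ1 k ω • z2 k s ω) atTop (𝓝 (x s ω)) := by
    intro s hs ω
    simp only [hz2s _ s hs]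
    exact (hx s hs ω).comp (hnt ω)
  have hbd : ∀ᵐ ω ∂μ, ℓ ω ≠ ⊤ → ∃ C : ℕ, ∀ k, ρ1 k ω * ‖z2 k t ω‖₊ ≤ C := by
    refine hH.ae_bounded_of_nearMin hc hz2 hz2min hρ1m (fun ω => ?_) (fun s hs ω => ?_) hℓ ?_
    · by_cases hω : ω ∈ G
      · exact ⟨1, fun k => (hρ1 ω hω _).le⟩
      · obtain ⟨C, hC⟩ := (hρ0 ω hω).bddAbove_range
        exact ⟨C, fun k => hC ⟨_, rfl⟩⟩
    · obtain ⟨C, hC⟩ := (hx2 s hs ω).nnnorm.bddAbove_range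
      refine ⟨C, fun k => ?_⟩
      rw [← nnnorm_nnreal_smul]
      exact hC ⟨k, rfl⟩
    · filter_upwards [hE2] with ω h k
      refine (h k).trans ?_
      gcongr
      rw [ENNReal.inv_le_one]
      exact le_add_self
  let L : Set Ω := {ω | ℓ ω ≠ ⊤ ∧ ∃ C : ℕ, ∀ k, ρ1 k ω * ‖z2 k t ω‖₊ ≤ C}
  have hL : MeasurableSet[𝓖 t] L := by
    have h1 : MeasurableSet[𝓖 t] {ω | ℓ ω ≠ ⊤} := hℓ (measurableSet_singleton ⊤).compl
    have h2 : MeasurableSet[𝓖 t] (⋃ C : ℕ, ⋂ k, {ω | ρ1 k ω * ‖z2 k t ω‖₊ ≤ (C : ℝ≥0)}) :=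
      MeasurableSet.iUnion fun C => MeasurableSet.iInter fun k =>
        measurableSet_le (mδ := 𝓖 t)
          ((hρ1m k).mul (measurable_nnnorm.comp ((hz2 k).measurable_self le_rfl))) measurable_const
    convert h1.inter h2 using 1
    ext ω
    simp [L]
  obtain ⟨n2, hn2, hn2mono, xt, hxt, hxtlim⟩ := exists_measurable_subseq_tendsto (mΩ := 𝓖 t)
    (fun k => L.indicator fun ω => ρ1 k ω • z2 k t ω)
    (fun k => ((hρ1m k).smul ((hz2 k).measurable_self le_rfl)).indicator hL) (fun ω => by
      by_cases hω : ω ∈ L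
      · obtain ⟨C, hC⟩ := hω.2
        refine ⟨C, fun k => ?_⟩
        rw [indicator_of_mem hω, ← coe_nnnorm, nnnorm_nnreal_smul]
        exact_mod_cast hC k
      · exact ⟨0, fun k => by simp [indicator_of_notMem hω]⟩)
  let z3 : ℕ → ℕ → Ω → Fin J → ℝ := fun k s ω => z2 (n2 k ω) s ω
  let ρ3 : ℕ → Ω → ℝ≥0 := fun k => L.indicator fun ω => ρ1 (n2 k ω) ω
  have hz3 : ∀ k, AdaptedFrom 𝓖 t (z3 k) := fun k => AdaptedFrom.comp_nat hH.mono hz2 (hn2 k)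
  have hρ3 : ∀ k, Measurable[𝓖 t] (ρ3 k) := fun k =>
    (measurable_comp_nat (mΩ := 𝓖 t) hρ1m (hn2 k)).indicator hL
  have hρ3L : ∀ k, ∀ ω ∈ L, ρ3 k ω = ρ1 (n2 k ω) ω := fun k ω hω => indicator_of_mem hω _
  have hρ3L' : ∀ k, ∀ ω ∉ L, ρ3 k ω = 0 := fun k ω hω => indicator_of_notMem hω _
  have hn2t : ∀ ω, Tendsto (fun k => n2 k ω) atTop atTop := fun ω => (hn2mono ω).tendsto_atTop
  have hE3 : ∀ᵐ ω ∂μ, ∀ k, (ρ3 k ω : ℝ≥0∞) * E (z3 k) ω ≤ ℓ ω + ((k : ℝ≥0∞) + 1)⁻¹ := by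
    filter_upwards [hE2, ae_all_iff.2 fun k => hH.condLExp_along_comp_nat hz2 (hn2 k)]
      with ω h1 h2 k
    by_cases hω : ω ∈ L
    · rw [hρ3L k ω hω]
      simp only [E, z3]
      rw [h2 k]
      refine (h1 (n2 k ω)).trans ?_
      gcongr
      exact (hn2mono ω).le_apply
    · simp [hρ3L' k ω hω]
  have hG3 : MeasurableSet[𝓖 t] (G ∩ L) := hG.inter hL
  let x3 : ℕ → Ω → Fin J → ℝ := fun s => if s = t then xt else L.indicator (x s)
  have hx3 : ∀ s < t + 1, ∀ ω, Tendsto (fun k => ρ3 k ω • z3 k s ω) atTop (𝓝 (x3 s ω)) := by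
    intro s hs ω
    rcases Nat.lt_succ_iff_lt_or_eq.1 hs with h | rfl
    · by_cases hω : ω ∈ L
      · simp only [x3, if_neg h.ne, indicator_of_mem hω, hρ3L _ ω hω]
        exact (hx2 s h ω).comp (hn2t ω)
      · simp [x3, if_neg h.ne, indicator_of_notMem hω, hρ3L' _ ω hω]
    · refine Tendsto.congr (fun k => ?_) (by simpa [x3] using hxtlim ω)
      by_cases hω : ω ∈ L
      · simp [indicator_of_mem hω, hρ3L _ ω hω, z3]
      · simp [indicator_of_notMem hω, hρ3L' _ ω hω]
  have hlim3 : ∀ᵐ ω ∂μ, ω ∈ Gᶜ →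
      liminf (fun k => (ρ3 k ω : ℝ≥0∞) * E (z3 k) ω) atTop = 0 := by
    filter_upwards [hE3, hlim] with ω h1 h2 hω
    have h3 : ℓ ω = 0 := h2 hω
    have h4 := tendsto_add_inv_nat (ℓ ω)
    rw [h3] at h4
    simp only [h3] at h1
    exact (tendsto_of_tendsto_of_tendsto_of_le_of_le tendsto_const_nhds h4 (fun _ => zero_le)
      h1).liminf_eq
  obtain ⟨y3, hy3, hy3x, hy3E, hy3R⟩ := hc z3 ρ3 x3 (G ∩ L) (fun k => (hz3 k).succ hH.mono)
    (fun k => (hρ3 k).mono (hH.mono t.le_succ) le_rfl) (hH.mono t.le_succ _ hG3)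
    (fun ω hω k => (hρ3L k ω hω.2).trans (hρ1 ω hω.1 _)) (fun ω hω => by
      by_cases hωL : ω ∈ L
      · have hωG : ω ∉ G := fun h => hω ⟨h, hωL⟩
        simp only [hρ3L _ ω hωL]
        exact ((hρ0 ω hωG).comp (hnt ω)).comp (hn2t ω)
      · simp [hρ3L' _ ω hωL]) hx3 (by
      filter_upwards [hH.ae_liminf_succ_eq_zero hG.compl hρ3 hlim3] with ω h1 hω
      by_cases hωL : ω ∈ L
      · exact h1 fun h => hω ⟨h, hωL⟩
      · simp [hρ3L' _ ω hωL])
  let y : ℕ → Ω → Fin J → ℝ := fun s => if s < t then x s else y3 s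
  have hy : AdaptedFrom 𝓖 t y := by
    intro s
    rcases lt_trichotomy s t with h | rfl | h
    · simp only [y, if_pos h]
      exact (AdaptedFrom.measurable_of_tendsto_smul hz hρ h.le (hx s h)).mono
        (hH.mono (le_max_right s t)) le_rfl
    · have h1 : y s = xt := by simp [y, hy3x s s.lt_succ_self, x3]
      rw [h1, max_self]
      exact hxt
    · simp only [y, if_neg h.not_gt]
      have := hy3 s
      rw [max_eq_left (Nat.succ_le_of_lt h)] at this
      rwa [max_eq_left h.le]
  have hyL : ∀ ω ∈ L, (fun s => y s ω) = fun s => y3 s ω := by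
    intro ω hω
    funext s
    by_cases hs : s < t
    · simp [y, hs, hy3x s (hs.trans t.lt_succ_self), x3, hs.ne, indicator_of_mem hω]
    · simp [y, hs]
  refine ⟨y, hy, fun s hs => by simp [y, hs], ?_, ?_⟩
  · have hy3m := hH.measurable_along hy3
    have hm3 : ∀ k, Measurable fun ω =>
        (ρ3 k ω : ℝ≥0∞) * condLExp (𝓖 (t + 1)) μ (along H (z3 k)) ω := fun k =>
      ((hρ3 k).mono (hH.le t) le_rfl).coe_nnreal_ennreal.mul (measurable_condLExp' _ _ _)
    filter_upwards [hbd, hE3,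
      condLExp_congr_on (μ := μ) (hH.le t) hL (hH.measurable_along hy) hy3m
        (ae_of_all _ fun ω hω => by simp only [along, hyL ω hω]),
      condLExp_condLExp (μ := μ) (hH.mono t.le_succ) (hH.le (t + 1)) (along H y3),
      condLExp_mono_on (hH.le t) hG3 (measurable_condLExp' _ _ _) (Measurable.liminf hm3) hy3E,
      condLExp_liminf_le (μ := μ) (hH.le t) hm3,
      ae_all_iff.2 fun k => hH.condLExp_mul_condLExp_succ (hρ3 k) (z3 k)]
      with ω h1 h2 h3 h4 h5 h6 h7 hωG
    change _ ≤ ℓ ω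
    by_cases hℓω : ℓ ω = ⊤
    · simp [hℓω]
    have hω : ω ∈ L := ⟨hℓω, h1 hℓω⟩
    rw [h3 hω, ← h4]
    refine (h5 ⟨hωG, hω⟩).trans (h6.trans ?_)
    simp_rw [h7]
    exact (liminf_le_liminf (Eventually.of_forall h2)).trans (tendsto_add_inv_nat _).liminf_eq.le
  · filter_upwards [hbd, hlim, hy3R] with ω h1 h2 h3 hωG
    have h4 : ℓ ω = 0 := h2 hωG
    have hℓω : ℓ ω ≠ ⊤ := by simp [h4]
    rw [hyL ω ⟨hℓω, h1 hℓω⟩]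
    exact h3 fun h => hωG h.1

/-- Existence of adapted minimizers of integral functionals of integrands whose adapted recession
directions form a linear space. -/
theorem exists_isMinimizer (hH : RecessionIntegrand μ 𝓖 N H R) :
    ∃ y : ℕ → Ω → Fin J → ℝ, (∀ s, Measurable[𝓖 s] (y s)) ∧
      ∀ z : ℕ → Ω → Fin J → ℝ, (∀ s, Measurable[𝓖 s] (z s)) →
        ∫⁻ ω, along H y ω ∂μ ≤ ∫⁻ ω, along H z ω ∂μ := by
  have hc : ClosedAt μ 𝓖 H R 0 :=
    Nat.decreasingInduction' (P := ClosedAt μ 𝓖 H R) (fun _ _ _ h => hH.closedAt_of_succ h)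
      N.zero_le hH.closedAt_top
  have hA : ∀ z : ℕ → Ω → Fin J → ℝ, AdaptedFrom 𝓖 0 z ↔ ∀ s, Measurable[𝓖 s] (z s) := by
    refine fun z => forall_congr' fun s => ?_
    rw [max_eq_left s.zero_le]
  let I : Set ℝ≥0∞ := (fun z => ∫⁻ ω, along H z ω ∂μ) '' {z | AdaptedFrom 𝓖 0 z}
  have hI : I.Nonempty := ⟨_, 0, (hA 0).2 fun _ => measurable_const, rfl⟩
  obtain ⟨u, -, hu, huI⟩ := exists_seq_tendsto_sInf hI (OrderBot.bddBelow I)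
  choose z hz hzu using huI
  obtain ⟨y, hy, -, hyE, -⟩ := hc z (fun _ _ => 1) 0 univ hz (fun _ => measurable_const)
    (@MeasurableSet.univ _ (𝓖 0)) (fun _ _ _ => rfl) (fun ω h => (h (mem_univ ω)).elim)
    (fun s hs => absurd hs s.not_lt_zero) (ae_of_all _ fun ω h => (h (mem_univ ω)).elim)
  refine ⟨y, (hA y).1 hy, fun w hw => ?_⟩
  have h1 : ∫⁻ ω, along H y ω ∂μ ≤ sInf I := by
    calc ∫⁻ ω, along H y ω ∂μ = ∫⁻ ω, condLExp (𝓖 0) μ (along H y) ω ∂μ :=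
          (lintegral_condLExp (hH.le 0) μ _).symm
      _ ≤ ∫⁻ ω, liminf (fun k => condLExp (𝓖 0) μ (along H (z k)) ω) atTop ∂μ := by
          refine lintegral_mono_ae ?_
          filter_upwards [hyE] with ω h
          simpa using h (mem_univ ω)
      _ ≤ liminf (fun k => ∫⁻ ω, condLExp (𝓖 0) μ (along H (z k)) ω ∂μ) atTop :=
          lintegral_liminf_le fun k => measurable_condLExp' _ _ _
      _ = liminf u atTop := by
          congr 1
          funext k
          rw [lintegral_condLExp (hH.le 0), ← hzu k]
      _ = sInf I := hu.liminf_eq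
  exact h1.trans (sInf_le ⟨w, (hA w).2 hw, rfl⟩)

end RecessionIntegrand

end AbstractExistence

section MarketPath

open scoped NNReal

variable {J T : ℕ}

/-- The increments of a path started at the origin. -/
def incr (x : ℕ → Fin J → ℝ) (t : ℕ) : Fin J → ℝ :=
  if t = 0 then x 0 else x t - x (t - 1)

lemma incr_zero (t : ℕ) : incr (0 : ℕ → Fin J → ℝ) t = 0 := by
  simp [incr]

lemma incr_add (x w : ℕ → Fin J → ℝ) (t : ℕ) : incr (x + w) t = incr x t + incr w t := by
  unfold incr
  split_ifs
  · simp
  · simp only [Pi.add_apply]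
    abel

lemma incr_smul (a : ℝ) (x : ℕ → Fin J → ℝ) (t : ℕ) :
    incr (fun s => a • x s) t = a • incr x t := by
  unfold incr
  split_ifs <;> simp [smul_sub]

lemma incr_congr {x w : ℕ → Fin J → ℝ} {t : ℕ} (h : ∀ s ≤ t, x s = w s) : incr x t = incr w t := by
  unfold incr
  rw [h 0 t.zero_le, h t le_rfl, h (t - 1) (t.sub_le 1)]

lemma tendsto_incr {y : ℕ → ℕ → Fin J → ℝ} {x : ℕ → Fin J → ℝ} {t : ℕ}
    (h : ∀ s < T + 1, Tendsto (fun k => y k s) atTop (𝓝 (x s))) (ht : t ≤ T) :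
    Tendsto (fun k => incr (y k) t) atTop (𝓝 (incr x t)) := by
  unfold incr
  split_ifs
  · exact h 0 (by omega)
  · exact (h t (by omega)).sub (h (t - 1) (by omega))

/-- The assumptions on the cost functions, constraints and disutility in a fixed scenario. -/
structure IsMarketPath (T : ℕ) (S : ℕ → (Fin J → ℝ) → EReal) (D : ℕ → Set (Fin J → ℝ))
    (V : (Fin (T + 1) → ℝ) → EReal) (m : ℝ) : Prop where
  lsc : ∀ t ≤ T, LowerSemicontinuous (S t)
  cvx : ∀ t ≤ T, EConvexOn (S t)
  zero : ∀ t ≤ T, S t 0 = 0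
  ne_bot : ∀ t ≤ T, ∀ x, S t x ≠ ⊥
  closed : ∀ t ≤ T, IsClosed (D t)
  convex : ∀ t ≤ T, Convex ℝ (D t)
  zero_mem : ∀ t ≤ T, (0 : Fin J → ℝ) ∈ D t
  V_lsc : LowerSemicontinuous V
  le_V : ∀ d, (m : EReal) ≤ V d
  V_mono : Monotone V
  V_hor : ∀ d, hor V d ≤ 0 → ∀ i, d i ≤ 0

/-- The total costs of a path, including the claims `c`. -/
def payments (T : ℕ) (S : ℕ → (Fin J → ℝ) → EReal) (c : ℕ → ℝ) (x : ℕ → Fin J → ℝ) :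
    Fin (T + 1) → ℝ :=
  fun i => (S i (incr x i)).toReal + c i

/-- The disutility of a path above its lower bound `m`, infinite for infeasible paths. -/
def pathCost (T : ℕ) (S : ℕ → (Fin J → ℝ) → EReal) (D : ℕ → Set (Fin J → ℝ)) (c : ℕ → ℝ)
    (V : (Fin (T + 1) → ℝ) → EReal) (m : ℝ) (x : ℕ → Fin J → ℝ) : ℝ≥0∞ :=
  if ∀ t ≤ T, x t ∈ D t ∧ S t (incr x t) ≠ ⊤ then (V (payments T S c x) - m).toENNReal else ⊤

lemma pathCost_congr {S : ℕ → (Fin J → ℝ) → EReal} {D : ℕ → Set (Fin J → ℝ)} {c : ℕ → ℝ}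
    {V : (Fin (T + 1) → ℝ) → EReal} {m : ℝ} {x w : ℕ → Fin J → ℝ} (h : ∀ t ≤ T, x t = w t) :
    pathCost T S D c V m x = pathCost T S D c V m w := by
  have h1 : ∀ t ≤ T, incr x t = incr w t := fun t ht => incr_congr fun s hs => h s (hs.trans ht)
  have h2 : payments T S c x = payments T S c w := by
    funext i
    simp only [payments, h1 i (Nat.lt_succ_iff.1 i.2)]
  have h3 : (∀ t ≤ T, x t ∈ D t ∧ S t (incr x t) ≠ ⊤) ↔
      ∀ t ≤ T, w t ∈ D t ∧ S t (incr w t) ≠ ⊤ :=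
    forall₂_congr fun t ht => by rw [h t ht, h1 t ht]
  simp only [pathCost, h2, h3]

/-- The directions which are admissible and free of cost at every scale. -/
def freeDirections (T : ℕ) (S : ℕ → (Fin J → ℝ) → EReal) (D : ℕ → Set (Fin J → ℝ)) :
    Set (ℕ → Fin J → ℝ) :=
  {w | ∀ t ≤ T, ∀ α : ℝ, 0 < α → α • w t ∈ D t ∧ S t (α • incr w t) ≤ 0}

lemma nonpos_of_hor {ι : Type*} [Fintype ι] {V : (ι → ℝ) → EReal}
    (hV : ∀ d, hor V d ≤ 0 → ∀ i, d i ≤ 0) {ρ : ℕ → ℝ} {d : ℕ → ι → ℝ} {e : ι → ℝ}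
    (hρ : Tendsto ρ atTop (𝓝 0)) (hd : Tendsto (fun k => ρ k • d k) atTop (𝓝 e))
    (h : ∀ ε : ℝ, 0 < ε → ∃ᶠ k in atTop, 0 < ρ k ∧ (ρ k : EReal) * V (d k) ≤ ε) :
    ∀ i, e i ≤ 0 := by
  refine hV e (iSup₂_le fun δ hδ => EReal.le_of_forall_lt_iff_le.1 fun ε hε => ?_)
  have hε : (0 : ℝ) < ε := by exact_mod_cast hε
  obtain ⟨k, ⟨hk0, hk⟩, hkδ, hkd⟩ := ((h ε hε).and_eventually
    ((hρ.eventually_lt_const hδ).and (hd.eventually (closedBall_mem_nhds e hδ)))).exists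
  refine (iInf₂_le (ρ k) ⟨hk0, hkδ⟩).trans ((iInf₂_le (ρ k • d k) hkd).trans ?_)
  rwa [inv_smul_smul₀ hk0.ne']

namespace IsMarketPath

variable {S : ℕ → (Fin J → ℝ) → EReal} {D : ℕ → Set (Fin J → ℝ)} {c : ℕ → ℝ}
  {V : (Fin (T + 1) → ℝ) → EReal} {m : ℝ}

lemma exists_real_lt (hM : IsMarketPath T S D V m) {t : ℕ} (ht : t ≤ T) (x : Fin J → ℝ) :
    ∃ r : ℝ, (r : EReal) < S t x := by
  obtain ⟨r, -, hr⟩ := EReal.lt_iff_exists_real_btwn.1 (bot_lt_iff_ne_bot.2 (hM.ne_bot t ht x))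
  exact ⟨r, hr⟩

lemma coe_toReal_S (hM : IsMarketPath T S D V m) {t : ℕ} (ht : t ≤ T) {x : Fin J → ℝ}
    (hx : S t x ≠ ⊤) : ((S t x).toReal : EReal) = S t x :=
  EReal.coe_toReal hx (hM.ne_bot t ht x)

lemma S_smul_le (hM : IsMarketPath T S D V m) {t : ℕ} (ht : t ≤ T) {x : Fin J → ℝ}
    (hx : S t x ≠ ⊤) {a : ℝ} (ha0 : 0 ≤ a) (ha1 : a ≤ 1) :
    S t (a • x) ≤ ((a * (S t x).toReal : ℝ) : EReal) := by
  have h := hM.cvx t ht x 0 a (1 - a) ha0 (by linarith) (by ring)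
  rw [smul_zero, add_zero, hM.zero t ht, mul_zero, add_zero, ← hM.coe_toReal_S ht hx] at h
  exact_mod_cast h

lemma pathCost_ne_top_iff {x : ℕ → Fin J → ℝ} :
    pathCost T S D c V m x ≠ ⊤ ↔
      (∀ t ≤ T, x t ∈ D t ∧ S t (incr x t) ≠ ⊤) ∧ V (payments T S c x) ≠ ⊤ := by
  unfold pathCost
  split_ifs with h
  · have h2 : V (payments T S c x) - m = ⊤ ↔ V (payments T S c x) = ⊤ := by
      induction V (payments T S c x) <;> simp [← EReal.coe_sub]
    simp only [ne_eq, EReal.toENNReal_eq_top_iff, h2]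
    tauto
  · simp [h]

lemma V_payments (hM : IsMarketPath T S D V m) {x : ℕ → Fin J → ℝ}
    (hx : pathCost T S D c V m x ≠ ⊤) :
    V (payments T S c x) = (((pathCost T S D c V m x).toReal + m : ℝ) : EReal) := by
  obtain ⟨h1, h2⟩ := pathCost_ne_top_iff.1 hx
  have h3 := hM.le_V (payments T S c x)
  rw [pathCost, if_pos h1]
  lift V (payments T S c x) to ℝ using ⟨h2, (lt_of_lt_of_le (EReal.bot_lt_coe m) h3).ne'⟩ with v
  have h4 : m ≤ v := by exact_mod_cast h3
  rw [← EReal.coe_sub, EReal.toENNReal_of_ne_top (EReal.coe_ne_top _), EReal.toReal_coe,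
    ENNReal.toReal_ofReal (by linarith)]
  simp

lemma pathCost_le_of_V_le {x : ℕ → Fin J → ℝ}
    (hx : ∀ t ≤ T, x t ∈ D t ∧ S t (incr x t) ≠ ⊤) {a : ℝ}
    (ha : V (payments T S c x) ≤ ((a + m : ℝ) : EReal)) :
    pathCost T S D c V m x ≤ ENNReal.ofReal a := by
  rw [pathCost, if_pos hx, ← EReal.real_coe_toENNReal]
  exact EReal.toENNReal_le_toENNReal (EReal.sub_le_of_le_add (by exact_mod_cast ha))

lemma nonpos_of_bounded (hM : IsMarketPath T S D V m) {d e : Fin (T + 1) → ℝ} {K : ℝ}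
    (h : ∀ n : ℕ, V (d + ((n : ℝ) + 1) • e) ≤ K) : ∀ i, e i ≤ 0 := by
  have h1 : Tendsto (fun n : ℕ => 1 / ((n : ℝ) + 1)) atTop (𝓝 0) :=
    tendsto_one_div_add_atTop_nhds_zero_nat
  refine nonpos_of_hor hM.V_hor h1 (d := fun n : ℕ => d + ((n : ℝ) + 1) • e) ?_ fun ε hε => ?_
  · have h2 : Tendsto (fun n : ℕ => (1 / ((n : ℝ) + 1)) • d + e) atTop (𝓝 ((0 : ℝ) • d + e)) :=
      (h1.smul_const d).add_const e
    rw [zero_smul, zero_add] at h2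
    refine h2.congr fun n => ?_
    rw [smul_add, smul_smul, one_div, inv_mul_cancel₀ (by positivity), one_smul]
  · have h2 := h1.mul_const K
    rw [zero_mul] at h2
    refine ((h2.eventually_lt_const hε).mono fun n hn => ⟨by positivity, ?_⟩).frequently
    refine (mul_le_mul_of_nonneg_left (h n) (by exact_mod_cast by positivity)).trans ?_
    exact_mod_cast hn.le

theorem pathCost_lsc (hM : IsMarketPath T S D V m) {y : ℕ → ℕ → Fin J → ℝ} {x : ℕ → Fin J → ℝ}
    (hy : ∀ s < T + 1, Tendsto (fun k => y k s) atTop (𝓝 (x s))) :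
    pathCost T S D c V m x ≤ liminf (fun k => pathCost T S D c V m (y k)) atTop := by
  by_contra! hlt
  obtain ⟨a, ha1, ha2⟩ := exists_between hlt
  lift a to ℝ≥0 using ha2.ne_top
  have hfreq : ∃ᶠ k in atTop, (∀ t ≤ T, y k t ∈ D t ∧ S t (incr (y k) t) ≠ ⊤) ∧
      V (payments T S c (y k)) ≤ ((a + m : ℝ) : EReal) := by
    refine (frequently_lt_of_liminf_lt (by isBoundedDefault) ha1).mono fun k hk => ?_
    refine ⟨(pathCost_ne_top_iff.1 hk.ne_top).1, ?_⟩
    rw [hM.V_payments hk.ne_top, EReal.coe_le_coe_iff]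
    have := ENNReal.toReal_mono ENNReal.coe_ne_top hk.le
    rw [ENNReal.coe_toReal] at this
    linarith
  have hD : ∀ t ≤ T, x t ∈ D t := fun t ht =>
    (hM.closed t ht).mem_of_frequently_of_tendsto (hfreq.mono fun k hk => (hk.1 t ht).1)
      (hy t (by omega))
  have hclaim : ∀ r : ℕ → ℝ, (∀ t ≤ T, (r t : EReal) < S t (incr x t)) →
      V (fun i => r i + c i) ≤ ((a + m : ℝ) : EReal) := by
    intro r hr
    have hev : ∀ᶠ k in atTop, ∀ t ∈ Set.Iic T, (r t : EReal) < S t (incr (y k) t) :=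
      (eventually_all_finite (finite_Iic T)).2 fun t ht =>
        (tendsto_incr hy ht).eventually (hM.lsc t ht _ _ (hr t ht))
    obtain ⟨k, ⟨hk1, hk2⟩, hk3⟩ := (hfreq.and_eventually hev).exists
    refine (hM.V_mono fun i => ?_).trans hk2
    have hi : (i : ℕ) ≤ T := Nat.lt_succ_iff.1 i.2
    have h1 := hk3 i hi
    rw [← hM.coe_toReal_S hi (hk1 i hi).2, EReal.coe_lt_coe_iff] at h1
    simp only [payments]
    linarith
  have hfin : ∀ t ≤ T, S t (incr x t) ≠ ⊤ := by
    intro t₀ ht₀ htop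
    have hr : ∀ t, ∃ r : ℝ, t ≤ T → (r : EReal) < S t (incr x t) := fun t => by
      by_cases ht : t ≤ T
      · exact (hM.exists_real_lt ht _).imp fun r hr _ => hr
      · exact ⟨0, fun h => absurd h ht⟩
    choose r hr using hr
    have := hM.nonpos_of_bounded (d := fun i => r i + c i)
      (e := Pi.single ⟨t₀, Nat.lt_succ_iff.2 ht₀⟩ 1) (K := a + m) (fun n => ?_)
      ⟨t₀, Nat.lt_succ_iff.2 ht₀⟩
    · rw [Pi.single_eq_same] at this
      linarith
    · refine (hM.V_mono fun i => ?_).trans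
        (hclaim (Function.update r t₀ (r t₀ + (n + 1))) fun t ht => ?_)
      · by_cases hi : (i : ℕ) = t₀
        · have : i = ⟨t₀, Nat.lt_succ_iff.2 ht₀⟩ := Fin.ext hi
          subst this
          simp
          linarith
        · have : i ≠ ⟨t₀, Nat.lt_succ_iff.2 ht₀⟩ := fun h => hi (by rw [h])
          simp [Function.update_of_ne hi, Pi.single_eq_of_ne this]
      · by_cases h : t = t₀
        · subst h
          rw [htop]
          exact EReal.coe_lt_top _
        · rw [Function.update_of_ne h]
          exact hr t ht
  have hV : V (payments T S c x) ≤ ((a + m : ℝ) : EReal) := by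
    by_contra! hcon
    have h1 : Tendsto (fun n : ℕ => fun i : Fin (T + 1) =>
        ((S i (incr x i)).toReal - 1 / ((n : ℝ) + 1)) + c i) atTop (𝓝 (payments T S c x)) := by
      refine tendsto_pi_nhds.2 fun i => ?_
      have := ((tendsto_one_div_add_atTop_nhds_zero_nat (𝕜 := ℝ)).const_sub
        (S i (incr x i)).toReal).add_const (c i)
      rwa [sub_zero] at this
    obtain ⟨n, hn⟩ := (h1.eventually (hM.V_lsc _ _ hcon)).exists
    refine absurd (hclaim (fun t => (S t (incr x t)).toReal - 1 / ((n : ℝ) + 1))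
      fun t ht => ?_) hn.not_ge
    rw [← hM.coe_toReal_S ht (hfin t ht), EReal.toReal_coe, EReal.coe_lt_coe_iff]
    exact sub_lt_self _ (by positivity)
  refine ha2.not_ge ((pathCost_le_of_V_le (fun t ht => ⟨hD t ht, hfin t ht⟩) hV).trans ?_)
  simp

theorem mem_freeDirections_of_recession (hM : IsMarketPath T S D V m) {ρ : ℕ → ℝ≥0}
    {y : ℕ → ℕ → Fin J → ℝ} {w : ℕ → Fin J → ℝ} (hρ : Tendsto ρ atTop (𝓝 0))
    (hw : ∀ s < T + 1, Tendsto (fun k => ρ k • y k s) atTop (𝓝 (w s)))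
    (hlim : liminf (fun k => (ρ k : ℝ≥0∞) * pathCost T S D c V m (y k)) atTop = 0) :
    w ∈ freeDirections T S D := by
  by_cases h0 : ∃ᶠ k in atTop, ρ k = 0
  · have hw0 : ∀ s ≤ T, w s = 0 := fun s hs =>
      isClosed_singleton.mem_of_frequently_of_tendsto (h0.mono fun k hk => by simp [hk])
        (hw s (by omega))
    intro t ht α _
    rw [hw0 t ht, incr_congr (w := 0) fun s hs => hw0 s (hs.trans ht), incr_zero, smul_zero]
    exact ⟨hM.zero_mem t ht, (hM.zero t ht).le⟩
  have hpos : ∀ᶠ k in atTop, 0 < ρ k := (not_frequently.1 h0).mono fun k hk => pos_iff_ne_zero.2 hk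
  have hρ' : Tendsto (fun k => (ρ k : ℝ)) atTop (𝓝 0) := NNReal.tendsto_coe.2 hρ
  have hfreq : ∀ ε : ℝ, 0 < ε → ∃ᶠ k in atTop, 0 < ρ k ∧
      (∀ t ≤ T, y k t ∈ D t ∧ S t (incr (y k) t) ≠ ⊤) ∧
      ((ρ k : ℝ) : EReal) * V (payments T S c (y k)) ≤ ε := by
    intro ε hε
    have h1 : ∃ᶠ k in atTop,
        (ρ k : ℝ≥0∞) * pathCost T S D c V m (y k) < ENNReal.ofReal (ε / 2) :=
      frequently_lt_of_liminf_lt (by isBoundedDefault) (by rw [hlim]; simpa using hε)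
    have h2 := hρ'.mul_const m
    rw [zero_mul] at h2
    refine (h1.and_eventually (hpos.and (h2.eventually_lt_const (half_pos hε)))).mono
      fun k ⟨hk1, hk2, hk3⟩ => ?_
    have h3 : pathCost T S D c V m (y k) ≠ ⊤ := fun h => by
      rw [h, ENNReal.mul_top (by exact_mod_cast hk2.ne')] at hk1
      exact not_top_lt hk1
    refine ⟨hk2, (pathCost_ne_top_iff.1 h3).1, ?_⟩
    rw [hM.V_payments h3]
    have h4 := (ENNReal.toReal_lt_toReal hk1.ne_top ENNReal.ofReal_ne_top).2 hk1
    rw [ENNReal.toReal_mul, ENNReal.coe_toReal, ENNReal.toReal_ofReal (half_pos hε).le] at h4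
    rw [← EReal.coe_mul, EReal.coe_le_coe_iff, mul_add]
    linarith
  have hsmall : ∀ α : ℝ, ∀ᶠ k in atTop, α * ρ k ≤ 1 := fun α => by
    have := hρ'.const_mul α
    rw [mul_zero] at this
    exact (this.eventually_lt_const one_pos).mono fun k hk => hk.le
  have hscale : ∀ t ≤ T, ∀ α : ℝ,
      Tendsto (fun k => (α * ρ k) • incr (y k) t) atTop (𝓝 (α • incr w t)) := by
    intro t ht α
    refine ((tendsto_incr hw ht).const_smul α).congr fun k => ?_
    rw [mul_smul, ← incr_smul (ρ k : ℝ)]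
    rfl
  refine fun t₀ ht₀ α hα => ⟨?_, ?_⟩
  · refine (hM.closed t₀ ht₀).mem_of_frequently_of_tendsto
      (f := fun k => (α * (ρ k : ℝ)) • y k t₀) (b := atTop) ?_ ?_
    · exact ((hfreq 1 one_pos).and_eventually (hsmall α)).mono fun k hk =>
        (hM.convex t₀ ht₀).smul_mem_of_zero_mem (hM.zero_mem t₀ ht₀) (hk.1.2.1 t₀ ht₀).1
          ⟨by positivity, hk.2⟩
    · exact ((hw t₀ (by omega)).const_smul α).congr fun k => (mul_smul α (ρ k : ℝ) _).symm
  · by_contra! hcon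
    let A : ℕ → ℝ := fun t => if t = t₀ then α else 1
    have hA : ∀ t, 0 < A t := fun t => by
      simp only [A]
      split_ifs
      exacts [hα, one_pos]
    have hr : ∀ t, ∃ r : ℝ, t ≤ T → (r : EReal) < S t (A t • incr w t) ∧ (t = t₀ → 0 < r) := by
      intro t
      by_cases h : t = t₀
      · subst h
        obtain ⟨r, hr1, hr2⟩ := EReal.lt_iff_exists_real_btwn.1 hcon
        exact ⟨r, fun _ => ⟨by simpa [A] using hr2, fun _ => by exact_mod_cast hr1⟩⟩
      · by_cases ht : t ≤ T
        · obtain ⟨r, hr⟩ := hM.exists_real_lt ht (A t • incr w t)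
          exact ⟨r, fun _ => ⟨hr, fun h' => absurd h' h⟩⟩
        · exact ⟨0, fun h => absurd h ht⟩
    choose r hr using hr
    let e : Fin (T + 1) → ℝ := fun i => r i / A i
    have hev : ∀ᶠ k in atTop, ∀ t ∈ Set.Iic T,
        (r t : EReal) < S t ((A t * ρ k) • incr (y k) t) ∧ A t * ρ k ≤ 1 :=
      (eventually_all_finite (finite_Iic T)).2 fun t ht =>
        ((hscale t ht (A t)).eventually (hM.lsc t ht _ _ (hr t ht).1)).and (hsmall (A t))
    have he := nonpos_of_hor hM.V_hor hρ' (d := fun k i => (ρ k : ℝ)⁻¹ * e i + c i) (e := e) ?_ ?_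
      ⟨t₀, Nat.lt_succ_iff.2 ht₀⟩
    · exact absurd he (not_le.2 (div_pos ((hr t₀ ht₀).2 rfl) (hA t₀)))
    · refine tendsto_pi_nhds.2 fun i => ?_
      have h1 := (hρ'.mul_const (c i)).const_add (e i)
      rw [zero_mul, add_zero] at h1
      refine h1.congr' (hpos.mono fun k hk => ?_)
      have hk' : (ρ k : ℝ) ≠ 0 := by exact_mod_cast hk.ne'
      simp only [Pi.smul_apply, smul_eq_mul]
      field_simp
    · intro ε hε
      refine ((hfreq ε hε).and_eventually hev).mono fun k ⟨⟨hk1, hk2, hk3⟩, hk4⟩ => ?_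
      have hk0 : (0 : ℝ) < ρ k := by exact_mod_cast hk1
      refine ⟨hk0, le_trans (mul_le_mul_of_nonneg_left (hM.V_mono fun i => ?_)
        (by exact_mod_cast hk0.le)) hk3⟩
      have hi : (i : ℕ) ≤ T := Nat.lt_succ_iff.1 i.2
      obtain ⟨h1, h2⟩ := hk4 i hi
      have h3 := h1.trans_le (hM.S_smul_le hi (hk2 i hi).2 (mul_pos (hA i) hk0).le h2)
      rw [EReal.coe_lt_coe_iff] at h3
      simp only [payments, e, add_le_add_iff_right]
      rw [inv_mul_le_iff₀ hk0, div_le_iff₀ (hA i)]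
      linarith

lemma S_add_le (hM : IsMarketPath T S D V m) {t : ℕ} (ht : t ≤ T) {x w : Fin J → ℝ}
    (hw : ∀ α : ℝ, 0 < α → S t (α • w) ≤ 0) : S t (x + w) ≤ S t x := by
  by_contra! hcon
  obtain ⟨q, hq1, hq2⟩ := EReal.lt_iff_exists_real_btwn.1 hcon
  rw [← hM.coe_toReal_S ht hcon.ne_top, EReal.coe_lt_coe_iff] at hq1
  have hl : Tendsto (fun n : ℕ => 1 / ((n : ℝ) + 1)) atTop (𝓝 0) :=
    tendsto_one_div_add_atTop_nhds_zero_nat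
  have h1 : Tendsto (fun n : ℕ => (1 - 1 / ((n : ℝ) + 1)) • x + w) atTop (𝓝 (x + w)) := by
    have := ((hl.const_sub 1).smul_const x).add_const w
    rwa [sub_zero, one_smul] at this
  have h2 : Tendsto (fun n : ℕ => (1 - 1 / ((n : ℝ) + 1)) * (S t x).toReal) atTop
      (𝓝 (S t x).toReal) := by
    have := (hl.const_sub 1).mul_const (S t x).toReal
    rwa [sub_zero, one_mul] at this
  obtain ⟨n, hn1, hn2⟩ := ((h1.eventually (hM.lsc t ht _ _ hq2)).and
    (h2.eventually_lt_const hq1)).exists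
  have hn0 : (0 : ℝ) < n + 1 := by positivity
  have h3 := hM.cvx t ht x (((n : ℝ) + 1) • w) (1 - 1 / ((n : ℝ) + 1)) (1 / ((n : ℝ) + 1))
    (by rw [sub_nonneg, div_le_one hn0]; linarith [n.cast_nonneg (α := ℝ)]) (by positivity)
    (by ring)
  rw [smul_smul, one_div_mul_cancel hn0.ne', one_smul, ← hM.coe_toReal_S ht hcon.ne_top] at h3
  have h4 := hn1.trans_le (h3.trans (add_le_add_right
    (mul_nonpos_of_nonneg_of_nonpos (by exact_mod_cast by positivity) (hw _ hn0)) _))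
  rw [add_zero, ← EReal.coe_mul, EReal.coe_lt_coe_iff] at h4
  linarith

lemma mem_D_add (hM : IsMarketPath T S D V m) {t : ℕ} (ht : t ≤ T) {x w : Fin J → ℝ}
    (hx : x ∈ D t) (hw : ∀ α : ℝ, 0 < α → α • w ∈ D t) : x + w ∈ D t := by
  have hl : Tendsto (fun n : ℕ => 1 / ((n : ℝ) + 1)) atTop (𝓝 0) :=
    tendsto_one_div_add_atTop_nhds_zero_nat
  have h1 : Tendsto (fun n : ℕ => (1 - 1 / ((n : ℝ) + 1)) • x + w) atTop (𝓝 (x + w)) := by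
    have := ((hl.const_sub 1).smul_const x).add_const w
    rwa [sub_zero, one_smul] at this
  refine (hM.closed t ht).mem_of_tendsto h1 (Eventually.of_forall fun n => ?_)
  have hn0 : (0 : ℝ) < n + 1 := by positivity
  have h3 := hM.convex t ht hx (hw _ hn0) (a := 1 - 1 / ((n : ℝ) + 1)) (b := 1 / ((n : ℝ) + 1))
    (by rw [sub_nonneg, div_le_one hn0]; linarith [n.cast_nonneg (α := ℝ)]) (by positivity)
    (by ring)
  rwa [smul_smul, one_div_mul_cancel hn0.ne', one_smul] at h3

theorem pathCost_add_le (hM : IsMarketPath T S D V m) (x : ℕ → Fin J → ℝ) {w : ℕ → Fin J → ℝ}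
    (hw : w ∈ freeDirections T S D) :
    pathCost T S D c V m (x + w) ≤ pathCost T S D c V m x := by
  by_cases hx : ∀ t ≤ T, x t ∈ D t ∧ S t (incr x t) ≠ ⊤
  · have hS : ∀ t ≤ T, S t (incr (x + w) t) ≤ S t (incr x t) := fun t ht => by
      rw [incr_add]
      exact hM.S_add_le ht fun α hα => (hw t ht α hα).2
    have hxw : ∀ t ≤ T, (x + w) t ∈ D t ∧ S t (incr (x + w) t) ≠ ⊤ := fun t ht =>
      ⟨hM.mem_D_add ht (hx t ht).1 fun α hα => (hw t ht α hα).1,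
        ((hS t ht).trans_lt (lt_top_iff_ne_top.2 (hx t ht).2)).ne⟩
    rw [pathCost, pathCost, if_pos hx, if_pos hxw]
    refine EReal.toENNReal_le_toENNReal (EReal.sub_le_sub (hM.V_mono fun i => ?_) le_rfl)
    have hi : (i : ℕ) ≤ T := Nat.lt_succ_iff.1 i.2
    exact add_le_add (EReal.toReal_le_toReal (hS i hi) (hM.ne_bot i hi _) (hx i hi).2) le_rfl
  · simp [pathCost, if_neg hx]

lemma smul_mem_freeDirections (hM : IsMarketPath T S D V m) {w : ℕ → Fin J → ℝ}
    (hw : w ∈ freeDirections T S D) {a : ℝ} (ha : 0 ≤ a) :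
    (fun s => a • w s) ∈ freeDirections T S D := by
  intro t ht α hα
  rw [incr_smul, smul_smul, smul_smul]
  rcases ha.eq_or_lt with rfl | ha
  · simpa using ⟨hM.zero_mem t ht, (hM.zero t ht).le⟩
  · exact hw t ht _ (mul_pos hα ha)

end IsMarketPath

end MarketPath

section Measurability

lemma measurableSet_mem_of_isClosed {Ω E : Type*} {mΩ : MeasurableSpace Ω} [PseudoMetricSpace E]
    [SecondCountableTopology E] [MeasurableSpace E] [BorelSpace E] {D : Ω → Set E}
    (hD : ∀ ω, IsClosed (D ω))
    (hmeas : ∀ O : Set E, IsOpen O → MeasurableSet {ω | (D ω ∩ O).Nonempty})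
    {z : Ω → E} (hz : Measurable z) : MeasurableSet {ω | z ω ∈ D ω} := by
  obtain ⟨Q, hQc, hQd⟩ := TopologicalSpace.exists_countable_dense E
  have heq : {ω | z ω ∈ D ω} = ⋂ n : ℕ, ⋃ q ∈ Q,
      {ω | dist (z ω) q < 1 / ((n : ℝ) + 1)} ∩
        {ω | (D ω ∩ ball q (1 / ((n : ℝ) + 1))).Nonempty} := by
    ext ω
    simp only [mem_iInter, mem_iUnion, mem_inter_iff, mem_ofPred_eq, exists_prop]
    constructor
    · intro h n
      obtain ⟨q, hq, hqQ⟩ := hQd.exists_mem_open (isOpen_ball (x := z ω) (ε := 1 / ((n : ℝ) + 1)))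
        ⟨z ω, mem_ball_self (by positivity)⟩
      have h1 : dist (z ω) q < 1 / ((n : ℝ) + 1) := mem_ball'.1 hqQ
      exact ⟨q, hq, h1, z ω, h, h1⟩
    · intro h
      rw [← (hD ω).closure_eq, Metric.mem_closure_iff]
      intro ε hε
      obtain ⟨n, hn⟩ := exists_nat_one_div_lt (half_pos hε)
      obtain ⟨q, -, h1, x, hx, hxq⟩ := h n
      refine ⟨x, hx, ?_⟩
      have h2 : dist x q < 1 / ((n : ℝ) + 1) := hxq
      linarith [dist_triangle_right (z ω) x q]
  rw [heq]
  exact MeasurableSet.iInter fun n => MeasurableSet.biUnion hQc fun q _ =>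
    (measurableSet_lt (hz.dist measurable_const) measurable_const).inter (hmeas _ isOpen_ball)

lemma measurable_toENNReal_sub {Ω : Type*} {mΩ : MeasurableSpace Ω} {g : Ω → EReal} {m : Ω → ℝ}
    (hg : Measurable g) (hm : Measurable m) : Measurable fun ω => (g ω - m ω).toENNReal := by
  have h : (fun ω => (g ω - m ω).toENNReal)
      = fun ω => if g ω = ⊤ then ⊤ else if g ω = ⊥ then 0 else
        ENNReal.ofReal ((g ω).toReal - m ω) := by
    funext ω
    induction g ω <;> simp [← EReal.coe_sub]
  rw [h]
  exact Measurable.ite (hg (measurableSet_singleton _)) measurable_const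
    (Measurable.ite (hg (measurableSet_singleton _)) measurable_const
      (hg.ereal_toReal.sub hm).ennreal_ofReal)

lemma eInt_eq_lintegral_add {Ω : Type*} [MeasurableSpace Ω] {μ : Measure Ω} {g : Ω → EReal}
    {m : Ω → ℝ} (hg : Measurable g) (hmm : Measurable m) (hm : Integrable m μ)
    (hmg : ∀ ω, (m ω : EReal) ≤ g ω) :
    eInt μ g = ((∫⁻ ω, (g ω - m ω).toENNReal ∂μ : ℝ≥0∞) : EReal) + ((∫ ω, m ω ∂μ : ℝ) : EReal) := by
  have hpos : ∀ x : EReal, ePos x = x.toENNReal := fun x => by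
    unfold ePos EReal.toENNReal
    split_ifs <;> rfl
  have hneg : ∀ ω, ePos (-(g ω)) ≤ ENNReal.ofReal (-m ω) := fun ω => by
    rw [hpos, ← EReal.real_coe_toENNReal, EReal.coe_neg]
    exact EReal.toENNReal_le_toENNReal (EReal.neg_le_neg_iff.2 (hmg ω))
  have hid : ∀ ω, ePos (g ω) + ENNReal.ofReal (-m ω)
      = (g ω - m ω).toENNReal + ENNReal.ofReal (m ω) + ePos (-(g ω)) := by
    intro ω
    have := hmg ω
    generalize g ω = x at this ⊢
    simp only [hpos]
    induction x with
    | bot => simp at this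
    | top => simp
    | coe x =>
      have hx : m ω ≤ x := by exact_mod_cast this
      rw [← EReal.coe_sub, ← EReal.coe_neg]
      simp only [EReal.real_coe_toENNReal]
      rw [← ENNReal.toReal_eq_toReal_iff' (by simp) (by simp),
        ENNReal.toReal_add (by simp) (by simp), ENNReal.toReal_add (by simp) (by simp),
        ENNReal.toReal_add (by simp) (by simp)]
      simp only [ENNReal.toReal_ofReal']
      rw [max_eq_left (sub_nonneg.2 hx)]
      have h1 := max_zero_sub_max_neg_zero_eq_self x
      have h2 := max_zero_sub_max_neg_zero_eq_self (m ω)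
      linarith
  have hfin1 : ∫⁻ ω, ENNReal.ofReal (m ω) ∂μ ≠ ⊤ := hm.lintegral_lt_top.ne
  have hfin2 : ∫⁻ ω, ENNReal.ofReal (-m ω) ∂μ ≠ ⊤ := hm.neg.lintegral_lt_top.ne
  have hfin3 : ∫⁻ ω, ePos (-(g ω)) ∂μ ≠ ⊤ := ((lintegral_mono hneg).trans_lt hfin2.lt_top).ne
  have hmeas : Measurable fun ω => ePos (-(g ω)) := by
    simp only [hpos]
    exact hg.neg.ereal_toENNReal
  have hmeas' : Measurable fun ω => ENNReal.ofReal (-m ω) := hmm.neg.ennreal_ofReal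
  have hsum := lintegral_congr (μ := μ) hid
  rw [lintegral_add_right _ hmeas', lintegral_add_right _ hmeas,
    lintegral_add_right _ hmm.ennreal_ofReal] at hsum
  rw [integral_eq_lintegral_pos_part_sub_lintegral_neg_part hm, eInt]
  generalize (∫⁻ ω, ePos (g ω) ∂μ) = A at *
  generalize (∫⁻ ω, ePos (-(g ω)) ∂μ) = B at *
  generalize (∫⁻ ω, ENNReal.ofReal (m ω) ∂μ) = P at *
  generalize (∫⁻ ω, ENNReal.ofReal (-m ω) ∂μ) = Q at *
  generalize (∫⁻ ω, (g ω - m ω).toENNReal ∂μ) = I at *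
  lift B to NNReal using hfin3
  lift P to NNReal using hfin1
  lift Q to NNReal using hfin2
  induction I with
  | top =>
    have hA : A = ⊤ := by
      by_contra h
      lift A to NNReal using h
      simp [← ENNReal.coe_add] at hsum
    subst hA
    rw [EReal.coe_ennreal_top, EReal.top_add_coe, EReal.coe_nnreal_eq_coe_real, ← EReal.coe_neg,
      EReal.top_add_coe]
  | coe I =>
    have hA : A ≠ ⊤ := fun h => by
      subst h
      simp [← ENNReal.coe_add] at hsum
    lift A to NNReal using hA
    have h1 : (A : ℝ) + Q = I + P + B := by exact_mod_cast hsum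
    simp only [ENNReal.coe_toReal, EReal.coe_nnreal_eq_coe_real]
    rw [← EReal.coe_neg, ← EReal.coe_add, ← EReal.coe_add, EReal.coe_eq_coe_iff]
    linarith

end Measurability

section Market

lemma mem_Dinf_iff {Ω : Type*} {J : ℕ} {D : ℕ → Ω → Set (Fin J → ℝ)} {t : ℕ} {ω : Ω}
    {w : Fin J → ℝ} : w ∈ Dinf D t ω ↔ ∀ α : ℝ, 0 < α → α • w ∈ D t ω := by
  simp only [Dinf, mem_iInter]
  constructor
  · intro h α hα
    have := h α⁻¹ (inv_pos.2 hα)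
    rwa [mem_smul_set_iff_inv_smul_mem₀ (inv_pos.2 hα).ne', inv_inv] at this
  · intro h α hα
    rw [mem_smul_set_iff_inv_smul_mem₀ hα.ne']
    exact h _ (inv_pos.2 hα)

lemma Sinf_nonpos_iff {Ω : Type*} {J : ℕ} {S : ℕ → (Fin J → ℝ) → Ω → EReal} {t : ℕ} {ω : Ω}
    {x : Fin J → ℝ} : Sinf S t x ω ≤ 0 ↔ ∀ α : ℝ, 0 < α → S t (α • x) ω ≤ 0 := by
  simp only [Sinf, iSup_le_iff]
  refine forall₂_congr fun α hα => ?_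
  have h0 : (0 : EReal) < ((α⁻¹ : ℝ) : EReal) := by exact_mod_cast inv_pos.2 hα
  constructor
  · intro h
    by_contra! hcon
    exact (EReal.mul_pos h0 hcon).not_ge h
  · exact fun h => mul_nonpos_of_nonneg_of_nonpos h0.le h

end Market

/-- existence of optimal strategies in the market model with convex cost
functions and portfolio constraints, under the linearity condition on the auxiliary
market model (S^∞, D^∞). -/
theorem existence_alm
    {Ω : Type*} {m0 : MeasurableSpace Ω} (μ : Measure Ω) [IsProbabilityMeasure μ]
    (hcomp : μ.IsComplete)
    (T J : ℕ)
    (F : ℕ → MeasurableSpace Ω)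
    (hFmono : ∀ s t : ℕ, s ≤ t → F s ≤ F t) (hFle : ∀ t, F t ≤ m0)
    -- the trading cost functions S_t
    (S : ℕ → (Fin J → ℝ) → Ω → EReal)
    (hSmeas : ∀ t ≤ T, Measurable[(inferInstance : MeasurableSpace (Fin J → ℝ)).prod (F t)]
      fun p : (Fin J → ℝ) × Ω => S t p.1 p.2)
    (hSlsc : ∀ t ≤ T, ∀ ω, LowerSemicontinuous fun x => S t x ω)
    (hScvx : ∀ t ≤ T, ∀ ω, EConvexOn fun x => S t x ω)
    (hS0 : ∀ t ≤ T, ∀ ω, S t 0 ω = 0)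
    (hSbot : ∀ t ≤ T, ∀ x ω, S t x ω ≠ ⊥)
    -- the portfolio constraints D_t
    (D : ℕ → Ω → Set (Fin J → ℝ))
    (hDmeas : ∀ t ≤ T, ∀ O : Set (Fin J → ℝ), IsOpen O →
      MeasurableSet[F t] {ω | (D t ω ∩ O).Nonempty})
    (hDclosed : ∀ t ≤ T, ∀ ω, IsClosed (D t ω))
    (hDcvx : ∀ t ≤ T, ∀ ω, Convex ℝ (D t ω))
    (hD0 : ∀ t ≤ T, ∀ ω, (0 : Fin J → ℝ) ∈ D t ω)
    (hDT : ∀ ω, D T ω = {(0 : Fin J → ℝ)})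
    -- the adapted payment process c
    (c : ℕ → Ω → ℝ) (hc : ∀ t ≤ T, Measurable[F t] (c t))
    -- the disutility function V
    (V : (Fin (T+1) → ℝ) → Ω → EReal)
    (hVmeas : Measurable fun p : (Fin (T+1) → ℝ) × Ω => V p.1 p.2)
    (hVlsc : ∀ ω, LowerSemicontinuous fun d => V d ω)
    (m : Ω → ℝ) (hm : Integrable m μ) (hVbd : ∀ d ω, (m ω : EReal) ≤ V d ω)
    (hV0 : ∀ ω, V 0 ω = 0)
    (hVmono : ∀ ω (d₁ d₂ : Fin (T+1) → ℝ), (∀ i, d₁ i ≤ d₂ i) → V d₁ ω ≤ V d₂ ω)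
    (hVw : ∀ ω (d : Fin (T+1) → ℝ),
      hor (fun e => V e ω) d
        = Filter.liminf (fun α : ℝ => ((α⁻¹ : ℝ) : EReal) * V (α • d) ω) Filter.atTop)
    (hVorth : ∀ ω (d : Fin (T+1) → ℝ), hor (fun e => V e ω) d ≤ 0 ↔ ∀ i, d i ≤ 0)
    -- the linearity condition: {z ∈ N_{D^∞} : S^∞(Δz) ≤ 0} is a linear space
    (hadd : ∀ z₁ z₂ : ℕ → Ω → Fin J → ℝ,
      (∀ t ≤ T, Measurable[F t] (z₁ t)) → (∀ t ≤ T, Measurable[F t] (z₂ t)) →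
      (∀ t ≤ T, ∀ᵐ ω ∂μ, z₁ t ω ∈ Dinf D t ω ∧ Sinf S t (dz z₁ t ω) ω ≤ 0) →
      (∀ t ≤ T, ∀ᵐ ω ∂μ, z₂ t ω ∈ Dinf D t ω ∧ Sinf S t (dz z₂ t ω) ω ≤ 0) →
      ∀ t ≤ T, ∀ᵐ ω ∂μ, (z₁ t ω + z₂ t ω) ∈ Dinf D t ω
        ∧ Sinf S t (dz (fun s ω' => z₁ s ω' + z₂ s ω') t ω) ω ≤ 0)
    (hsmul : ∀ z : ℕ → Ω → Fin J → ℝ, (∀ t ≤ T, Measurable[F t] (z t)) →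
      (∀ t ≤ T, ∀ᵐ ω ∂μ, z t ω ∈ Dinf D t ω ∧ Sinf S t (dz z t ω) ω ≤ 0) → ∀ a : ℝ,
      ∀ t ≤ T, ∀ᵐ ω ∂μ, (a • z t ω) ∈ Dinf D t ω
        ∧ Sinf S t (dz (fun s ω' => a • z s ω') t ω) ω ≤ 0) :
    -- conclusion: the infimum over N_D is attained
    ∃ zs : ℕ → Ω → Fin J → ℝ,
      ((∀ t ≤ T, Measurable[F t] (zs t)) ∧ (∀ t ≤ T, ∀ᵐ ω ∂μ, zs t ω ∈ D t ω)) ∧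
      objAlm μ S c V zs
        = ⨅ (z : ℕ → Ω → Fin J → ℝ)
            (_ : (∀ t ≤ T, Measurable[F t] (z t)) ∧ (∀ t ≤ T, ∀ᵐ ω ∂μ, z t ω ∈ D t ω)),
            objAlm μ S c V z := by
  have hmm : Measurable m := hm.aemeasurable.nullMeasurable.measurable_of_complete
  let 𝓖 : ℕ → MeasurableSpace Ω := fun t => if t ≤ T then F t else m0
  have h𝓖F : ∀ t ≤ T, 𝓖 t = F t := fun t ht => if_pos ht
  let H : (ℕ → Fin J → ℝ) → Ω → ℝ≥0∞ := fun x ω => pathCost T (fun t x => S t x ω)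
    (fun t => D t ω) (fun t => c t ω) (fun d => V d ω) (m ω) x
  let R : Ω → Set (ℕ → Fin J → ℝ) := fun ω => freeDirections T (fun t x => S t x ω)
    (fun t => D t ω)
  have hM : ∀ ω, IsMarketPath T (fun t x => S t x ω) (fun t => D t ω) (fun d => V d ω) (m ω) :=
    fun ω =>
      { lsc := fun t ht => hSlsc t ht ω
        cvx := fun t ht => hScvx t ht ω
        zero := fun t ht => hS0 t ht ω
        ne_bot := fun t ht x => hSbot t ht x ω
        closed := fun t ht => hDclosed t ht ω
        convex := fun t ht => hDcvx t ht ω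
        zero_mem := fun t ht => hD0 t ht ω
        V_lsc := hVlsc ω
        le_V := fun d => hVbd d ω
        V_mono := fun d₁ d₂ h => hVmono ω d₁ d₂ h
        V_hor := fun d => (hVorth ω d).1 }
  have hSm : ∀ (z : ℕ → Ω → Fin J → ℝ), (∀ t ≤ T, Measurable (z t)) → ∀ t ≤ T,
      Measurable fun ω => S t (dz z t ω) ω := by
    intro z hz t ht
    have h1 : Measurable (dz z t) := by
      unfold dz
      split_ifs with h0
      · exact hz 0 T.zero_le
      · exact (hz t ht).sub (hz (t - 1) ((t.sub_le 1).trans ht))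
    exact ((hSmeas t ht).mono (sup_le_sup le_rfl (MeasurableSpace.comap_mono (hFle t)))
      le_rfl).comp (h1.prodMk measurable_id)
  have hVm : ∀ (z : ℕ → Ω → Fin J → ℝ), (∀ t ≤ T, Measurable (z t)) →
      Measurable fun ω => V (fun i : Fin (T + 1) => (S i (dz z i ω) ω).toReal + c i ω) ω := by
    intro z hz
    refine hVmeas.comp (Measurable.prodMk (measurable_pi_lambda _ fun i => ?_) measurable_id)
    have hi : (i : ℕ) ≤ T := Nat.lt_succ_iff.1 i.2
    exact (hSm z hz i hi).ereal_toReal.add ((hc i hi).mono (hFle i) le_rfl)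
  have hfin : ∀ (z : ℕ → Ω → Fin J → ℝ), (∀ t ≤ T, Measurable (z t)) → ∀ t ≤ T,
      MeasurableSet {ω | S t (dz z t ω) ω ≠ ⊤} := fun z hz t ht =>
    (hSm z hz t ht (measurableSet_singleton _)).compl
  have hforall : ∀ P : ℕ → Ω → Prop, (∀ t ≤ T, MeasurableSet {ω | P t ω}) →
      MeasurableSet {ω | ∀ t ≤ T, P t ω} := by
    intro P hP
    simp only [ofPred_forall]
    exact MeasurableSet.iInter fun t => MeasurableSet.iInter fun ht => hP t ht
  have hH : RecessionIntegrand μ 𝓖 (T + 1) H R :=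
    { mono := by
        intro s t hst
        simp only [𝓖]
        split_ifs with h1 h2
        exacts [hFmono s t hst, hFle s, absurd (hst.trans ‹_›) h1, le_rfl]
      le := by
        intro t
        simp only [𝓖]
        split_ifs
        exacts [hFle t, le_rfl]
      top := if_neg (by omega)
      meas := by
        intro z hz
        refine Measurable.ite (hforall (fun t ω => z t ω ∈ D t ω ∧ S t (dz z t ω) ω ≠ ⊤)
          fun t ht => ?_) (measurable_toENNReal_sub (hVm z fun t _ => hz t) hmm) measurable_const
        exact (measurableSet_mem_of_isClosed (hDclosed t ht)
          (fun O hO => hFle t _ (hDmeas t ht O hO)) (hz t)).inter (hfin z (fun t _ => hz t) t ht)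
      lsc := fun ω y x hy => (hM ω).pathCost_lsc hy
      recession := fun ω ρ y w hρ hw h => (hM ω).mem_freeDirections_of_recession hρ hw h
      add_le := fun ω x w hw => (hM ω).pathCost_add_le x hw
      smul_mem := fun ω w a hw => (hM ω).smul_mem_freeDirections hw a.coe_nonneg
      neg_mem := by
        intro w hw hwR
        have h1 := hsmul w (fun t ht => h𝓖F t ht ▸ hw t) (fun t ht => hwR.mono fun ω hω =>
          ⟨mem_Dinf_iff.2 fun α hα => (hω t ht α hα).1,
            Sinf_nonpos_iff.2 fun α hα => (hω t ht α hα).2⟩) (-1)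
        have h2 : ∀ᵐ ω ∂μ, ∀ t ≤ T, ((-1 : ℝ) • w t ω) ∈ Dinf D t ω ∧
            Sinf S t (dz (fun s ω' => (-1 : ℝ) • w s ω') t ω) ω ≤ 0 :=
          ae_all_iff.2 fun t => ae_all_iff.2 fun ht => h1 t ht
        refine h2.mono fun ω hω t ht α hα => ?_
        have h3 : -(fun s => w s ω) = fun s => (-1 : ℝ) • w s ω := by
          funext s
          simp
        rw [h3]
        exact ⟨mem_Dinf_iff.1 (hω t ht).1 α hα, Sinf_nonpos_iff.1 (hω t ht).2 α hα⟩ }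
  let trunc : (ℕ → Ω → Fin J → ℝ) → ℕ → Ω → Fin J → ℝ := fun z s => if s ≤ T then z s else 0
  have htrunc : ∀ z : ℕ → Ω → Fin J → ℝ, (∀ t ≤ T, Measurable[F t] (z t)) →
      ∀ s, Measurable[𝓖 s] (trunc z s) := by
    intro z hz s
    by_cases h : s ≤ T
    · rw [h𝓖F s h]
      simpa only [trunc, if_pos h] using hz s h
    · simp only [trunc, if_neg h]
      exact measurable_const
  have hobj : ∀ z : ℕ → Ω → Fin J → ℝ, (∀ t ≤ T, Measurable[F t] (z t)) →
      (∀ t ≤ T, ∀ᵐ ω ∂μ, z t ω ∈ D t ω) → objAlm μ S c V z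
        = ((∫⁻ ω, along H (trunc z) ω ∂μ : ℝ≥0∞) : EReal) + ((∫ ω, m ω ∂μ : ℝ) : EReal) := by
    intro z hz hzD
    have hz' : ∀ t ≤ T, Measurable (z t) := fun t ht => (hz t ht).mono (hFle t) le_rfl
    rw [objAlm, eInt_eq_lintegral_add ?_ hmm hm fun ω => ?_]
    · congr 2
      have hD' : ∀ᵐ ω ∂μ, ∀ t ≤ T, z t ω ∈ D t ω :=
        ae_all_iff.2 fun t => ae_all_iff.2 fun ht => hzD t ht
      refine lintegral_congr_ae (hD'.mono fun ω hω => ?_)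
      have h1 : ∀ t ≤ T, trunc z t ω = z t ω := fun t ht => by simp only [trunc, if_pos ht]
      have h2 : ∀ t ≤ T, incr (fun s => trunc z s ω) t = dz z t ω := fun t ht =>
        incr_congr fun s hs => h1 s (hs.trans ht)
      have h3 : payments T (fun t x => S t x ω) (fun t => c t ω) (fun s => trunc z s ω)
          = fun i : Fin (T + 1) => (S i (dz z i ω) ω).toReal + c i ω := by
        funext i
        simp only [payments, h2 i (Nat.lt_succ_iff.1 i.2)]
      have h4 : (∀ t ≤ T, trunc z t ω ∈ D t ω ∧ S t (incr (fun s => trunc z s ω) t) ω ≠ ⊤) ↔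
          ∀ t ≤ T, S t (dz z t ω) ω ≠ ⊤ :=
        forall₂_congr fun t ht => by
          rw [h1 t ht, h2 t ht]
          exact and_iff_right (hω t ht)
      simp only [along, H, pathCost, h3, h4]
      split_ifs <;> simp
    · exact Measurable.ite (hforall _ (hfin z hz')) (hVm z hz') measurable_const
    · split_ifs
      exacts [hVbd _ ω, le_top]
  obtain ⟨y, hy, hmin⟩ := hH.exists_isMinimizer
  obtain ⟨zs, hzs, hzsD, hopt⟩ : ∃ zs : ℕ → Ω → Fin J → ℝ, (∀ t ≤ T, Measurable[F t] (zs t)) ∧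
      (∀ t ≤ T, ∀ᵐ ω ∂μ, zs t ω ∈ D t ω) ∧ ∀ z : ℕ → Ω → Fin J → ℝ, (∀ s, Measurable[𝓖 s] (z s)) →
        ∫⁻ ω, along H (trunc zs) ω ∂μ ≤ ∫⁻ ω, along H z ω ∂μ := by
    by_cases htop : ∫⁻ ω, along H y ω ∂μ = ⊤
    · exact ⟨0, fun t _ => measurable_const, fun t ht => ae_of_all μ (hD0 t ht), fun z hz =>
        le_top.trans (htop ▸ hmin z hz)⟩
    · have hfinite := ae_lt_top (hH.meas y fun s => (hy s).mono (hH.le s) le_rfl) htop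
      refine ⟨y, fun t ht => h𝓖F t ht ▸ hy t, fun t ht => hfinite.mono fun ω hω =>
        ((IsMarketPath.pathCost_ne_top_iff.1 (show H _ ω ≠ ⊤ from hω.ne)).1 t ht).1, fun z hz => ?_⟩
      refine le_trans (le_of_eq (lintegral_congr fun ω => ?_)) (hmin z hz)
      have h1 : ∀ t ≤ T, trunc y t ω = y t ω := fun t ht => by simp only [trunc, if_pos ht]
      simp only [along, H]
      exact pathCost_congr h1
  refine ⟨zs, ⟨hzs, hzsD⟩, le_antisymm (le_iInf₂ fun z hz => ?_) (iInf₂_le zs ⟨hzs, hzsD⟩)⟩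
  rw [hobj zs hzs hzsD, hobj z hz.1 hz.2]
  exact add_le_add (by exact_mod_cast hopt _ (htrunc z hz.1)) le_rfl

end
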